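/- arXiv:2303.04264 — 3 statements merged into one kernel-verified Lean document; each statement's English description precedes it below -/
import Mathlib

section
/- Let 0 ≤ k ≤ n and i ≥ 0 with k − 2i ≥ 0. Then the operator F^{(i)} maps ker(F^{(i+1)}) ∩ Λ_A^k into ker(F) ∩ Λ_A^{k−2i}, and this map is surjective: F^{(i)}·(ker(F^{(i+1)}) ∩ Λ_A^k) = ker(F) ∩ Λ_A^{k−2i}. -/
noncomputable section

/-- The field `𝔽 = ℚ(q)`. -/
abbrev Fq : Type := RatFunc ℚ

/-- The quantum parameter `q`. -/
def qv : Fq := RatFunc.X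

/-- The index set `I = {1,…,n} ∪ {−n,…,−1}` as a finset of integers. -/
def Iset (n : ℕ) : Finset ℤ := (Finset.Icc (-(n : ℤ)) (n : ℤ)).erase 0

/-- Subsets of `I`, the index type for the standard basis. -/
abbrev Bset (n : ℕ) : Type := {S : Finset ℤ // S ⊆ Iset n}

/-- `Λ`, the free `𝔽`-vector space with basis `{v_S : S ⊆ I}`. -/
abbrev Lam (n : ℕ) : Type := Bset n →₀ Fq

/-- The standard basis vector `v_S`. -/
def bv (n : ℕ) (S : Bset n) : Lam n := Finsupp.single S 1

/-- The standard basis vector `v_T` for a finset `T ⊆ I` (and `0` for junk input). -/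
def vS (n : ℕ) (T : Finset ℤ) : Lam n :=
  if h : T ⊆ Iset n then Finsupp.single (⟨T, h⟩ : Bset n) (1 : Fq) else 0

/-- The linear operator on `Λ` determined by prescribed values on the standard basis. -/
def mkOp (n : ℕ) (g : Bset n → Lam n) : Module.End Fq (Lam n) :=
  Finsupp.linearCombination Fq g

/-- The four positions `{i, i+1, −i, −(i+1)}`. -/
def quad (i : ℤ) : Finset ℤ := {i, i + 1, -i, -(i + 1)}

/-- Value of `f_i` on `v_S`. -/
def fAct (n : ℕ) (i : ℤ) (S : Finset ℤ) : Lam n :=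
  if i = (n : ℤ) then
    (if (n : ℤ) ∈ S ∧ -(n : ℤ) ∉ S then vS n (insert (-(n : ℤ)) (S.erase (n : ℤ))) else 0)
  else
    (if S ∩ quad i = {i} then vS n (insert (i + 1) (S.erase i))
     else if S ∩ quad i = {-(i + 1)} then vS n (insert (-i) (S.erase (-(i + 1))))
     else if S ∩ quad i = ({i, -(i + 1)} : Finset ℤ) then
       vS n (insert (-i) (S.erase (-(i + 1)))) + qv⁻¹ • vS n (insert (i + 1) (S.erase i))
     else if S ∩ quad i = ({i, -i} : Finset ℤ) then qv • vS n (insert (i + 1) (S.erase i))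
     else if S ∩ quad i = ({i + 1, -(i + 1)} : Finset ℤ) then
       vS n (insert (-i) (S.erase (-(i + 1))))
     else if S ∩ quad i = ({i, -(i + 1), -i} : Finset ℤ) then vS n (insert (i + 1) (S.erase i))
     else if S ∩ quad i = ({i, i + 1, -(i + 1)} : Finset ℤ) then
       vS n (insert (-i) (S.erase (-(i + 1))))
     else 0)

/-- Value of `e_i` on `v_S`. -/
def eAct (n : ℕ) (i : ℤ) (S : Finset ℤ) : Lam n :=
  if i = (n : ℤ) then
    (if -(n : ℤ) ∈ S ∧ (n : ℤ) ∉ S then vS n (insert (n : ℤ) (S.erase (-(n : ℤ)))) else 0)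
  else
    (if S ∩ quad i = {-i} then vS n (insert (-(i + 1)) (S.erase (-i)))
     else if S ∩ quad i = {i + 1} then vS n (insert i (S.erase (i + 1)))
     else if S ∩ quad i = ({i + 1, -i} : Finset ℤ) then
       vS n (insert i (S.erase (i + 1))) + qv⁻¹ • vS n (insert (-(i + 1)) (S.erase (-i)))
     else if S ∩ quad i = ({i, -i} : Finset ℤ) then qv • vS n (insert (-(i + 1)) (S.erase (-i)))
     else if S ∩ quad i = ({i + 1, -(i + 1)} : Finset ℤ) then vS n (insert i (S.erase (i + 1)))
     else if S ∩ quad i = ({i, i + 1, -i} : Finset ℤ) then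
       vS n (insert (-(i + 1)) (S.erase (-i)))
     else if S ∩ quad i = ({i + 1, -(i + 1), -i} : Finset ℤ) then vS n (insert i (S.erase (i + 1)))
     else 0)

/-- Coefficient of `ε_j` in `wt(S)`. -/
def epsCoef (S : Finset ℤ) (j : ℤ) : ℤ :=
  (if j ∈ S then 1 else 0) - (if -j ∈ S then 1 else 0)

/-- The pairing `(α_i, wt S)`. -/
def alphaPair (n : ℕ) (i : ℤ) (S : Finset ℤ) : ℤ :=
  if i = (n : ℤ) then 2 * epsCoef S (n : ℤ) else epsCoef S i - epsCoef S (i + 1)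

/-- The operator `f_i` on `Λ`. -/
def fop (n : ℕ) (i : ℤ) : Module.End Fq (Lam n) := mkOp n (fun S => fAct n i S.1)

/-- The operator `e_i` on `Λ`. -/
def eop (n : ℕ) (i : ℤ) : Module.End Fq (Lam n) := mkOp n (fun S => eAct n i S.1)

/-- The operator `k_i` on `Λ`, `k_i · v_S = q^{(α_i, wt S)} v_S`. -/
def kop (n : ℕ) (i : ℤ) : Module.End Fq (Lam n) :=
  mkOp n (fun S => (qv ^ alphaPair n i S.1) • bv n S)

/-- The operator `k_i⁻¹` on `Λ`. -/
def kinvop (n : ℕ) (i : ℤ) : Module.End Fq (Lam n) :=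
  mkOp n (fun S => (qv ^ (-alphaPair n i S.1)) • bv n S)

/-- `−S`. -/
def negSet (S : Finset ℤ) : Finset ℤ := S.image (fun x => -x)

/-- `S₀ = S ∩ (−S)`, the fully dotted columns. -/
def Szero (S : Finset ℤ) : Finset ℤ := S ∩ negSet S

/-- `S₀^c = (I∖S) ∩ (−(I∖S))`, the undotted columns. -/
def Szeroc (n : ℕ) (S : Finset ℤ) : Finset ℤ := (Iset n \ S) ∩ negSet (Iset n \ S)

/-- `w(S) = (|S₀| − |S₀^c|)/2`. -/
def wTot (n : ℕ) (S : Finset ℤ) : ℤ :=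
  (((Szero S).card : ℤ) - ((Szeroc n S).card : ℤ)) / 2

/-- `w_{>i}(S)`. -/
def wGt (n : ℕ) (i : ℤ) (S : Finset ℤ) : ℤ :=
  ((((Szero S).filter (fun x => i < |x| ∧ |x| ≤ (n : ℤ))).card : ℤ)
    - (((Szeroc n S).filter (fun x => i < |x| ∧ |x| ≤ (n : ℤ))).card : ℤ)) / 2

/-- `w_{<i}(S)`. -/
def wLt (n : ℕ) (i : ℤ) (S : Finset ℤ) : ℤ :=
  ((((Szeroc n S).filter (fun x => x ≠ 0 ∧ |x| < i)).card : ℤ)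
    - (((Szero S).filter (fun x => x ≠ 0 ∧ |x| < i)).card : ℤ)) / 2

/-- Value of `E` on `v_S`. -/
def EAct (n : ℕ) (S : Finset ℤ) : Lam n :=
  ∑ i ∈ (Finset.Icc (1 : ℤ) (n : ℤ)).filter (fun i => i ∈ Szeroc n S ∧ -i ∈ Szeroc n S),
    ((-qv) ^ wGt n i S) • vS n (insert i (insert (-i) S))

/-- Value of `F` on `v_S`. -/
def FAct (n : ℕ) (S : Finset ℤ) : Lam n :=
  ∑ i ∈ (Finset.Icc (1 : ℤ) (n : ℤ)).filter (fun i => i ∈ Szero S ∧ -i ∈ Szero S),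
    ((-qv) ^ wLt n i S) • vS n ((S.erase i).erase (-i))

/-- The operator `E` on `Λ`. -/
def Eop (n : ℕ) : Module.End Fq (Lam n) := mkOp n (fun S => EAct n S.1)

/-- The operator `F` on `Λ`. -/
def Fop (n : ℕ) : Module.End Fq (Lam n) := mkOp n (fun S => FAct n S.1)

/-- The operator `K` on `Λ`, `K · v_S = (−q)^{w(S)} v_S`. -/
def Kop (n : ℕ) : Module.End Fq (Lam n) := mkOp n (fun S => ((-qv) ^ wTot n S.1) • bv n S)

/-- The operator `K⁻¹` on `Λ`. -/
def Kinvop (n : ℕ) : Module.End Fq (Lam n) :=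
  mkOp n (fun S => ((-qv) ^ (-wTot n S.1)) • bv n S)

/-- Balanced quantum integer `[m]_x`. -/
def qNum (x : Fq) (m : ℕ) : Fq := (x ^ (m : ℤ) - x ^ (-(m : ℤ))) / (x - x⁻¹)

/-- Quantum factorial `[m]_x!`. -/
def qFact (x : Fq) (m : ℕ) : Fq := ∏ j ∈ Finset.range m, qNum x (j + 1)

/-- Gaussian binomial coefficient in the variable `x`. -/
def qBinom (x : Fq) (m s : ℕ) : Fq := qFact x m / (qFact x s * qFact x (m - s))

/-- The variable `q_i`: `q` for `i < n` and `q²` for `i = n`. -/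
def qsub (n : ℕ) (i : ℤ) : Fq := if i = (n : ℤ) then qv ^ 2 else qv

/-- The subring `A = ℤ[q,q⁻¹] ⊆ 𝔽`. -/
def Asub : Subring Fq := Subring.closure {qv, qv⁻¹}

/-- The `A`-lattice `Λ_A ⊆ Λ`: the `A`-span of all `v_S`. -/
def LamA (n : ℕ) : Set (Lam n) :=
  {x | ∃ c : Bset n →₀ Fq, (∀ S, c S ∈ Asub) ∧ x = c.sum (fun S a => a • bv n S)}

/-- The degree-`k` part `Λ^k ⊆ Λ`. -/
def Lk (n k : ℕ) : Submodule Fq (Lam n) :=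
  Submodule.span Fq {x | ∃ S : Bset n, S.1.card = k ∧ x = bv n S}

/-- The divided power `E^{(m)} = E^m/[m]!`. -/
def Ediv (n : ℕ) (m : ℕ) : Module.End Fq (Lam n) := (qFact qv m)⁻¹ • (Eop n ^ m)

/-- The divided power `F^{(m)} = F^m/[m]!`. -/
def Fdiv (n : ℕ) (m : ℕ) : Module.End Fq (Lam n) := (qFact qv m)⁻¹ • (Fop n ^ m)

lemma mkOp_single (n : ℕ) (g : Bset n → Lam n) (S : Bset n) (c : Fq) :
    mkOp n g (Finsupp.single S c) = c • g S := by
  simp [mkOp]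

lemma end_ext {n : ℕ} {M : Type*} [AddCommGroup M] [Module Fq M] {f g : Lam n →ₗ[Fq] M}
    (h : ∀ S, f (bv n S) = g (bv n S)) : f = g :=
  Finsupp.lhom_ext' fun S => LinearMap.ext_ring (h S)

lemma vS_of_subset {n : ℕ} {T : Finset ℤ} (h : T ⊆ Iset n) : vS n T = bv n ⟨T, h⟩ := by
  simp [vS, bv, h]

lemma mem_Iset {n : ℕ} {x : ℤ} : x ∈ Iset n ↔ x ≠ 0 ∧ -(n : ℤ) ≤ x ∧ x ≤ n := by
  simp [Iset]

lemma mem_Szero {S : Finset ℤ} {x : ℤ} : x ∈ Szero S ↔ x ∈ S ∧ -x ∈ S := by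
  simp only [Szero, negSet, Finset.mem_inter, Finset.mem_image]
  exact and_congr_right fun _ => ⟨by rintro ⟨y, hy, rfl⟩; simpa using hy, fun h => ⟨-x, h, neg_neg x⟩⟩

lemma mem_Szeroc {n : ℕ} {S : Finset ℤ} {x : ℤ} :
    x ∈ Szeroc n S ↔ x ∈ Iset n ∧ x ∉ S ∧ -x ∉ S := by
  simp only [Szeroc, negSet, Finset.mem_inter, Finset.mem_image, Finset.mem_sdiff, mem_Iset]
  constructor
  · rintro ⟨⟨h1, h2⟩, y, ⟨h3, h4⟩, rfl⟩
    exact ⟨h1, h2, by simpa using h4⟩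
  · rintro ⟨h1, h2, h3⟩
    exact ⟨⟨h1, h2⟩, -x, ⟨by omega, h3⟩, neg_neg x⟩

/-! ### Scalars -/

lemma qv_ne_zero : qv ≠ 0 := RatFunc.X_ne_zero

lemma qv_pow_ne_one {m : ℕ} (hm : m ≠ 0) : qv ^ m ≠ 1 := by
  intro h
  have h2 : algebraMap (Polynomial ℚ) Fq (Polynomial.X ^ m) = algebraMap (Polynomial ℚ) Fq 1 := by
    simpa [qv] using h
  have h3 := congrArg Polynomial.natDegree (RatFunc.algebraMap_injective ℚ h2)
  simp at h3
  exact hm h3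

lemma qv_sub_inv_ne_zero : qv - qv⁻¹ ≠ 0 := by
  intro h
  apply qv_pow_ne_one (m := 2) two_ne_zero
  have h0 := qv_ne_zero
  field_simp at h
  linear_combination h

lemma qNum_ne_zero (m : ℕ) : qNum qv (m + 1) ≠ 0 := by
  refine div_ne_zero (fun h => ?_) qv_sub_inv_ne_zero
  apply qv_pow_ne_one (m := 2 * (m + 1)) (by omega)
  have h0 := pow_ne_zero (m + 1) qv_ne_zero
  rw [zpow_neg, zpow_natCast] at h
  field_simp at h
  rw [mul_comm 2, pow_mul]
  linear_combination h

lemma qNum_succ_succ (m : ℕ) :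
    qNum qv (m + 2) = qv⁻¹ * qNum qv (m + 1) + qv ^ (m + 1) := by
  have h0 := qv_ne_zero
  have h1 := qv_sub_inv_ne_zero
  simp only [qNum]
  rw [div_eq_iff h1, add_mul, mul_assoc, div_mul_cancel₀ _ h1, zpow_neg, zpow_neg, zpow_natCast,
    zpow_natCast]
  field_simp
  ring

lemma qFact_succ (m : ℕ) : qFact qv (m + 1) = qFact qv m * qNum qv (m + 1) := by
  simp [qFact, Finset.prod_range_succ]

lemma qFact_ne_zero (m : ℕ) : qFact qv m ≠ 0 :=
  Finset.prod_ne_zero_iff.2 fun j _ => qNum_ne_zero j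

lemma qv_zpow_mem (s : ℤ) : qv ^ s ∈ Asub := by
  have h1 : qv ∈ Asub := Subring.subset_closure (by simp)
  have h2 : qv⁻¹ ∈ Asub := Subring.subset_closure (by simp)
  obtain ⟨m, rfl | rfl⟩ := s.eq_nat_or_neg
  · simpa using pow_mem h1 m
  · simpa using pow_mem h2 m

lemma neg_qv_zpow_mem (s : ℤ) : (-qv) ^ s ∈ Asub := by
  rcases Int.even_or_odd s with h | h
  · rw [h.neg_zpow]; exact qv_zpow_mem s
  · rw [h.neg_zpow]; exact neg_mem (qv_zpow_mem s)

/-! ### Adding one column -/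

/-- The embedding of index sets which prescribes the membership of `±(n+1)`. -/
def extendSet (n : ℕ) (a b : Bool) (S : Bset n) : Bset (n + 1) :=
  ⟨(Iset (n + 1)).filter
    (fun x => x ∈ S.1 ∨ (a = true ∧ x = n + 1) ∨ (b = true ∧ x = -(n + 1))),
    Finset.filter_subset _ _⟩

lemma abs_le_of_mem {n : ℕ} (S : Bset n) {x : ℤ} (hx : x ∈ S.1) : x ≠ 0 ∧ -(n : ℤ) ≤ x ∧ x ≤ n :=
  mem_Iset.1 (S.2 hx)

lemma mem_extendSet {n : ℕ} {a b : Bool} {S : Bset n} {x : ℤ} :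
    x ∈ (extendSet n a b S).1 ↔
      x ∈ S.1 ∨ (a = true ∧ x = n + 1) ∨ (b = true ∧ x = -(n + 1)) := by
  simp only [extendSet, Finset.mem_filter, and_iff_right_iff_imp, mem_Iset]
  rintro (h | h | h)
  · have := abs_le_of_mem S h
    push_cast; omega
  · push_cast; omega
  · push_cast; omega

lemma mem_extendSet_of_abs_le {n : ℕ} {a b : Bool} {S : Bset n} {x : ℤ}
    (h1 : -(n : ℤ) ≤ x) (h2 : x ≤ n) : x ∈ (extendSet n a b S).1 ↔ x ∈ S.1 := by
  rw [mem_extendSet]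
  constructor
  · rintro (h | h | h)
    · exact h
    · omega
    · omega
  · exact Or.inl

lemma succ_mem_extendSet {n : ℕ} {a b : Bool} {S : Bset n} :
    (n + 1 : ℤ) ∈ (extendSet n a b S).1 ↔ a = true := by
  rw [mem_extendSet]
  constructor
  · rintro (h | h | h)
    · have := abs_le_of_mem S h
      omega
    · exact h.1
    · omega
  · exact fun h => Or.inr (Or.inl ⟨h, rfl⟩)

lemma neg_succ_mem_extendSet {n : ℕ} {a b : Bool} {S : Bset n} :
    (-(n + 1) : ℤ) ∈ (extendSet n a b S).1 ↔ b = true := by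
  rw [mem_extendSet]
  constructor
  · rintro (h | h | h)
    · have := abs_le_of_mem S h
      omega
    · omega
    · exact h.1
  · exact fun h => Or.inr (Or.inr ⟨h, rfl⟩)

lemma extendSet_inj {n : ℕ} {a b a' b' : Bool} {S S' : Bset n}
    (h : extendSet n a b S = extendSet n a' b' S') : a = a' ∧ b = b' ∧ S = S' := by
  refine ⟨?_, ?_, ?_⟩
  · rw [Bool.eq_iff_iff, ← succ_mem_extendSet (b := b) (S := S), h, succ_mem_extendSet]
  · rw [Bool.eq_iff_iff, ← neg_succ_mem_extendSet (a := a) (S := S), h, neg_succ_mem_extendSet]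
  · ext x
    by_cases hx : -(n : ℤ) ≤ x ∧ x ≤ n
    · rw [← mem_extendSet_of_abs_le (a := a) (b := b) hx.1 hx.2, h,
        mem_extendSet_of_abs_le hx.1 hx.2]
    · exact iff_of_false (fun h => hx (abs_le_of_mem S h).2) (fun h => hx (abs_le_of_mem S' h).2)

lemma extendSet_injective (n : ℕ) (a b : Bool) : Function.Injective (extendSet n a b) :=
  fun _ _ h => (extendSet_inj h).2.2

lemma exists_extendSet {n : ℕ} (T : Bset (n + 1)) : ∃ a b S, T = extendSet n a b S := by
  refine ⟨decide ((n + 1 : ℤ) ∈ T.1), decide ((-(n + 1) : ℤ) ∈ T.1),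
    ⟨T.1 ∩ Iset n, Finset.inter_subset_right⟩, ?_⟩
  ext x
  rw [mem_extendSet]
  simp only [Finset.mem_inter, decide_eq_true_eq, mem_Iset]
  constructor
  · intro h
    have h2 := abs_le_of_mem T h
    push_cast at h2
    by_cases h3 : x = n + 1
    · subst h3; exact Or.inr (Or.inl ⟨h, rfl⟩)
    · by_cases h4 : x = -(n + 1)
      · subst h4; exact Or.inr (Or.inr ⟨h, rfl⟩)
      · exact Or.inl ⟨h, by omega⟩
  · rintro (h | ⟨h, rfl⟩ | ⟨h, rfl⟩)
    · exact h.1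
    · exact h
    · exact h

lemma card_extendSet {n : ℕ} (a b : Bool) (S : Bset n) :
    (extendSet n a b S).1.card = S.1.card + a.toNat + b.toNat := by
  have h1 : (n + 1 : ℤ) ∉ S.1 := fun h => by have := abs_le_of_mem S h; omega
  have h2 : (-(n + 1) : ℤ) ∉ S.1 := fun h => by have := abs_le_of_mem S h; omega
  have h3 : (extendSet n a b S).1 = (S.1 ∪ (if a then {(n + 1 : ℤ)} else ∅)) ∪
      (if b then {(-(n + 1) : ℤ)} else ∅) := by
    ext x
    rw [mem_extendSet]
    cases a <;> cases b <;> simp <;> tauto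
  rw [h3]
  have h4 : (-(n + 1) : ℤ) ≠ n + 1 := by omega
  rw [Finset.card_union_of_disjoint, Finset.card_union_of_disjoint]
  · cases a <;> cases b <;> simp
  · cases a <;> simp [h1]
  · cases a <;> cases b <;> simp [h2, h4, -neg_add_rev]

/-- The linear embedding `Λ(n) → Λ(n+1)` induced by `extendSet`. -/
def extendMap (n : ℕ) (a b : Bool) : Lam n →ₗ[Fq] Lam (n + 1) :=
  Finsupp.lmapDomain Fq Fq (extendSet n a b)

/-- The component of an element of `Λ(n+1)` along `extendMap`. -/
def compMap (n : ℕ) (a b : Bool) : Lam (n + 1) →ₗ[Fq] Lam n :=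
  Finsupp.lcomapDomain (extendSet n a b) (extendSet_injective n a b)

lemma compMap_apply (n : ℕ) (a b : Bool) (y : Lam (n + 1)) (S : Bset n) :
    compMap n a b y S = y (extendSet n a b S) := rfl

lemma extendMap_bv (n : ℕ) (a b : Bool) (S : Bset n) :
    extendMap n a b (bv n S) = bv (n + 1) (extendSet n a b S) := by
  simp [extendMap, bv]

lemma extendMap_apply (n : ℕ) (a b c d : Bool) (x : Lam n) (S : Bset n) :
    extendMap n a b x (extendSet n c d S) = if a = c ∧ b = d then x S else 0 := by
  split_ifs with h
  · obtain ⟨rfl, rfl⟩ := h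
    exact Finsupp.mapDomain_apply (extendSet_injective n a b) x S
  · refine Finsupp.mapDomain_of_notMem_range _ _ ?_
    rintro ⟨S', hS⟩
    exact h ⟨(extendSet_inj hS).1, (extendSet_inj hS).2.1⟩

lemma compMap_extendMap (n : ℕ) (a b c d : Bool) (x : Lam n) :
    compMap n c d (extendMap n a b x) = if a = c ∧ b = d then x else 0 := by
  ext S
  rw [compMap_apply, extendMap_apply]
  split_ifs <;> rfl

lemma sum_extendMap_compMap (n : ℕ) (y : Lam (n + 1)) :
    y = extendMap n false false (compMap n false false y) +
      extendMap n true true (compMap n true true y) +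
      extendMap n false true (compMap n false true y) +
      extendMap n true false (compMap n true false y) := by
  ext T
  obtain ⟨a, b, S, rfl⟩ := exists_extendSet T
  simp only [Finsupp.add_apply, extendMap_apply, compMap_apply]
  cases a <;> cases b <;> simp

/-! ### The graded lattice -/

/-- The elements of `Λ_A` which are homogeneous of degree `k`. -/
def latticeDeg (n : ℕ) (k : ℤ) : AddSubgroup (Lam n) where
  carrier := {x | ∀ S, x S ∈ Asub ∧ ((S.1.card : ℤ) ≠ k → x S = 0)}
  zero_mem' := fun S => ⟨zero_mem _, fun _ => rfl⟩
  add_mem' := fun {x y} hx hy S => ⟨add_mem (hx S).1 (hy S).1, fun h => by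
    rw [Finsupp.add_apply, (hx S).2 h, (hy S).2 h, add_zero]⟩
  neg_mem' := fun {x} hx S => ⟨neg_mem (hx S).1, fun h => by
    rw [Finsupp.neg_apply, (hx S).2 h, neg_zero]⟩

lemma mem_latticeDeg {n : ℕ} {k : ℤ} {x : Lam n} :
    x ∈ latticeDeg n k ↔ ∀ S, x S ∈ Asub ∧ ((S.1.card : ℤ) ≠ k → x S = 0) := Iff.rfl

lemma mem_latticeDeg_iff {n k : ℕ} {x : Lam n} :
    x ∈ latticeDeg n k ↔ x ∈ LamA n ∧ x ∈ Lk n k := by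
  have hA : x ∈ LamA n ↔ ∀ S, x S ∈ Asub := by
    have hs (c : Bset n →₀ Fq) : c.sum (fun S a => a • bv n S) = c := by
      simp [bv]
    constructor
    · rintro ⟨c, hc, rfl⟩
      rwa [hs]
    · exact fun h => ⟨x, h, (hs x).symm⟩
  have hL : Lk n k = Finsupp.supported Fq Fq {S : Bset n | S.1.card = k} := by
    rw [Finsupp.supported_eq_span_single, Lk]
    congr 1
    ext y
    simp [bv, eq_comm]
  rw [hA, hL, Finsupp.mem_supported', mem_latticeDeg]
  constructor
  · exact fun h => ⟨fun S => (h S).1, fun S hS => (h S).2 (by exact_mod_cast hS)⟩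
  · exact fun h S => ⟨h.1 S, fun hS => h.2 S (by exact_mod_cast hS)⟩

lemma smul_mem_latticeDeg {n : ℕ} {k : ℤ} {x : Lam n} {c : Fq} (hc : c ∈ Asub)
    (hx : x ∈ latticeDeg n k) : c • x ∈ latticeDeg n k := fun S =>
  ⟨mul_mem hc (hx S).1, fun h => by rw [Finsupp.smul_apply, (hx S).2 h, smul_zero]⟩

lemma extendMap_mem {n : ℕ} {k l : ℤ} {a b : Bool} {x : Lam n} (hx : x ∈ latticeDeg n k)
    (hl : l = k + a.toNat + b.toNat) : extendMap n a b x ∈ latticeDeg (n + 1) l := by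
  intro T
  obtain ⟨c, d, S, rfl⟩ := exists_extendSet T
  rw [extendMap_apply]
  split_ifs with h
  · obtain ⟨rfl, rfl⟩ := h
    refine ⟨(hx S).1, fun h => (hx S).2 fun h' => h ?_⟩
    rw [card_extendSet]
    push_cast
    omega
  · exact ⟨zero_mem _, fun _ => rfl⟩

lemma compMap_mem {n : ℕ} {k l : ℤ} {a b : Bool} {y : Lam (n + 1)}
    (hy : y ∈ latticeDeg (n + 1) l) (hl : l = k + a.toNat + b.toNat) :
    compMap n a b y ∈ latticeDeg n k := by
  intro S
  rw [compMap_apply]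
  refine ⟨(hy _).1, fun h => (hy _).2 fun h' => h ?_⟩
  rw [card_extendSet] at h'
  push_cast at h'
  omega

/-! ### The weight operators -/

/-- The operator scaling `v_S` by `(−q)^{−s·w(S)}`. -/
def weightOp (n : ℕ) (s : ℤ) : Module.End Fq (Lam n) :=
  mkOp n (fun S => ((-qv) ^ (s * wLt n (n + 1) S.1)) • bv n S)

lemma weightOp_bv (n : ℕ) (s : ℤ) (S : Bset n) :
    weightOp n s (bv n S) = ((-qv) ^ (s * wLt n (n + 1) S.1)) • bv n S := by
  simp [weightOp, bv, mkOp_single]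

lemma weightOp_apply (n : ℕ) (s : ℤ) (x : Lam n) (S : Bset n) :
    weightOp n s x S = (-qv) ^ (s * wLt n (n + 1) S.1) * x S := by
  classical
  induction x using Finsupp.induction_linear with
  | zero => simp
  | add x y hx hy => simp [hx, hy, mul_add]
  | single T c =>
    simp only [weightOp, mkOp_single, bv, Finsupp.smul_apply, Finsupp.single_apply, smul_eq_mul]
    split_ifs with h
    · subst h; ring
    · simp

lemma weightOp_mem {n : ℕ} {k : ℤ} {x : Lam n} (s : ℤ) (hx : x ∈ latticeDeg n k) :
    weightOp n s x ∈ latticeDeg n k := fun S => by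
  rw [weightOp_apply]
  exact ⟨mul_mem (neg_qv_zpow_mem _) (hx S).1, fun h => by rw [(hx S).2 h, mul_zero]⟩

lemma weightOp_neg (n : ℕ) (s : ℤ) (x : Lam n) : weightOp n s (weightOp n (-s) x) = x := by
  ext S
  have h : (-qv) ≠ 0 := neg_ne_zero.2 qv_ne_zero
  rw [weightOp_apply, weightOp_apply, ← mul_assoc, ← zpow_add₀ h]
  simp

lemma Fop_bv (n : ℕ) (S : Bset n) : Fop n (bv n S) = FAct n S.1 := by
  simp [Fop, bv, mkOp_single]

lemma erase_erase_subset {n : ℕ} (S : Bset n) (i j : ℤ) : (S.1.erase i).erase j ⊆ Iset n :=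
  ((Finset.erase_subset _ _).trans (Finset.erase_subset _ _)).trans S.2

lemma filter_abs_lt_succ {n : ℕ} {T : Finset ℤ} (h : T ⊆ Iset n) :
    T.filter (fun x => x ≠ 0 ∧ |x| < (n : ℤ) + 1) = T := by
  refine Finset.filter_true_of_mem fun x hx => ?_
  have := mem_Iset.1 (h hx)
  exact ⟨this.1, by rw [abs_lt]; omega⟩

lemma wLt_succ {n : ℕ} (S : Bset n) :
    wLt n (n + 1) S.1 = ((Szeroc n S.1).card - (Szero S.1).card : ℤ) / 2 := by
  rw [wLt, filter_abs_lt_succ, filter_abs_lt_succ]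
  · exact fun x hx => S.2 (mem_Szero.1 hx).1
  · exact fun x hx => (mem_Szeroc.1 hx).1

lemma wLt_erase {n : ℕ} (S : Bset n) {i : ℤ} (hi : i ∈ Szero S.1) :
    wLt n (n + 1) ((S.1.erase i).erase (-i)) = wLt n (n + 1) S.1 + 2 := by
  have h0 := (abs_le_of_mem S (mem_Szero.1 hi).1)
  have hS := mem_Szero.1 hi
  have hne : -i ≠ i := by omega
  have h1 : Szero ((S.1.erase i).erase (-i)) = ((Szero S.1).erase i).erase (-i) := by
    ext x
    simp only [mem_Szero, Finset.mem_erase]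
    constructor
    · rintro ⟨⟨h1, h2, h3⟩, h4, h5, h6⟩; exact ⟨h1, h2, h3, h6⟩
    · rintro ⟨h1, h2, h3, h6⟩; exact ⟨⟨h1, h2, h3⟩, by omega, by omega, h6⟩
  have h2 : Szeroc n ((S.1.erase i).erase (-i)) = insert i (insert (-i) (Szeroc n S.1)) := by
    ext x
    simp only [mem_Szeroc, Finset.mem_erase, Finset.mem_insert, mem_Iset]
    by_cases hx : x = i
    · subst hx; simp; omega
    by_cases hx' : x = -i
    · subst hx'; simp; omega
    have h3 : -x ≠ -i := by omega
    have h4 : -x ≠ i := by omega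
    simp [hx, hx', h3, h4]
  have h3 : -i ∈ (Szero S.1).erase i :=
    Finset.mem_erase.2 ⟨hne, mem_Szero.2 ⟨hS.2, by simpa using hS.1⟩⟩
  have h4 : (-i) ∉ Szeroc n S.1 := fun h => (mem_Szeroc.1 h).2.1 hS.2
  have h5 : i ∉ insert (-i) (Szeroc n S.1) := by
    rw [Finset.mem_insert]
    rintro (h | h)
    · exact hne h.symm
    · exact (mem_Szeroc.1 h).2.1 hS.1
  have c1 := Finset.card_erase_add_one h3
  have c2 := Finset.card_erase_add_one hi
  have c3 := Finset.card_insert_of_notMem h5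
  have c4 := Finset.card_insert_of_notMem h4
  have e1 := wLt_succ (⟨_, erase_erase_subset S i (-i)⟩ : Bset n)
  simp only [h1, h2] at e1
  rw [e1, wLt_succ S]
  omega

lemma Fop_weightOp (n : ℕ) (s : ℤ) (x : Lam n) :
    Fop n (weightOp n s x) = (-qv) ^ (-2 * s) • weightOp n s (Fop n x) := by
  suffices h : Fop n ∘ₗ weightOp n s = (-qv) ^ (-2 * s) • (weightOp n s ∘ₗ Fop n) from
    LinearMap.congr_fun h x
  refine end_ext fun S => ?_
  have hq : (-qv) ≠ 0 := neg_ne_zero.2 qv_ne_zero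
  simp only [LinearMap.comp_apply, LinearMap.smul_apply, weightOp_bv, map_smul, Fop_bv, FAct,
    map_sum, Finset.smul_sum]
  refine Finset.sum_congr rfl fun i hi => ?_
  rw [vS_of_subset (erase_erase_subset S i (-i)), weightOp_bv,
    wLt_erase S (Finset.mem_filter.1 hi).2.1]
  simp only [smul_smul]
  congr 1
  simp only [← zpow_add₀ hq]
  congr 1
  ring

/-! ### The operator `F` and its divided powers in terms of the last column -/

lemma wLt_extendSet {n : ℕ} {a b : Bool} (S : Bset n) {i : ℤ} (hi : i ≤ n + 1) :
    wLt (n + 1) i (extendSet n a b S).1 = wLt n i S.1 := by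
  have key (x : ℤ) (hx : |x| < i) : -(n : ℤ) ≤ x ∧ x ≤ n ∧ -(n : ℤ) ≤ -x ∧ -x ≤ n := by
    rw [abs_lt] at hx
    omega
  have h1 : (Szeroc (n + 1) (extendSet n a b S).1).filter (fun x => x ≠ 0 ∧ |x| < i) =
      (Szeroc n S.1).filter (fun x => x ≠ 0 ∧ |x| < i) := by
    ext x
    simp only [Finset.mem_filter, mem_Szeroc, mem_Iset]
    refine and_congr_left fun h => ?_
    obtain ⟨k1, k2, k3, k4⟩ := key x h.2
    rw [mem_extendSet_of_abs_le k1 k2, mem_extendSet_of_abs_le k3 k4]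
    push_cast
    refine and_congr_left fun _ => ?_
    omega
  have h2 : (Szero (extendSet n a b S).1).filter (fun x => x ≠ 0 ∧ |x| < i) =
      (Szero S.1).filter (fun x => x ≠ 0 ∧ |x| < i) := by
    ext x
    simp only [Finset.mem_filter, mem_Szero]
    refine and_congr_left fun h => ?_
    obtain ⟨k1, k2, k3, k4⟩ := key x h.2
    rw [mem_extendSet_of_abs_le k1 k2, mem_extendSet_of_abs_le k3 k4]
  rw [wLt, wLt, h1, h2]

lemma erase_extendSet {n : ℕ} {a b : Bool} (S : Bset n) {i : ℤ} (h1 : 1 ≤ i) (h2 : i ≤ n) :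
    ((extendSet n a b S).1.erase i).erase (-i) =
      (extendSet n a b ⟨_, erase_erase_subset S i (-i)⟩).1 := by
  ext x
  simp only [mem_extendSet, Finset.mem_erase]
  constructor
  · tauto
  · rintro (h | h | h)
    · tauto
    · exact ⟨by omega, by omega, Or.inr (Or.inl h)⟩
    · exact ⟨by omega, by omega, Or.inr (Or.inr h)⟩

lemma erase_extendSet_last {n : ℕ} (S : Bset n) :
    ((extendSet n true true S).1.erase (n + 1)).erase (-(n + 1)) =
      (extendSet n false false S).1 := by
  ext x
  simp only [mem_extendSet, Finset.mem_erase]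
  constructor
  · rintro ⟨h1, h2, h | h | h⟩
    · exact Or.inl h
    · exact absurd h.2 h2
    · exact absurd h.2 h1
  · rintro (h | h | h)
    · have := abs_le_of_mem S h
      exact ⟨by omega, by omega, Or.inl h⟩
    · exact absurd h.1 (by simp)
    · exact absurd h.1 (by simp)

lemma FAct_extendSet {n : ℕ} (a b : Bool) (S : Bset n) :
    FAct (n + 1) (extendSet n a b S).1 = extendMap n a b (FAct n S.1) +
      if a = true ∧ b = true then extendMap n false false (weightOp n 1 (bv n S)) else 0 := by
  have hI : Finset.Icc (1 : ℤ) ((n + 1 : ℕ) : ℤ) =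
      insert ((n : ℤ) + 1) (Finset.Icc (1 : ℤ) (n : ℤ)) := by
    ext x
    simp only [Finset.mem_Icc, Finset.mem_insert]
    push_cast
    omega
  have hn : ((n : ℤ) + 1) ∉ Finset.Icc (1 : ℤ) (n : ℤ) := by simp
  rw [FAct, Finset.sum_filter, hI, Finset.sum_insert hn, FAct, Finset.sum_filter, map_sum]
  refine (add_comm _ _).trans ?_
  congr 1
  · refine Finset.sum_congr rfl fun i hi => ?_
    rw [Finset.mem_Icc] at hi
    have hmem : i ∈ Szero (extendSet n a b S).1 ∧ -i ∈ Szero (extendSet n a b S).1 ↔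
        i ∈ Szero S.1 ∧ -i ∈ Szero S.1 := by
      simp only [mem_Szero, neg_neg]
      rw [mem_extendSet_of_abs_le (by omega) (by omega),
        mem_extendSet_of_abs_le (by omega) (by omega)]
    simp only [hmem]
    split_ifs
    · rw [wLt_extendSet S (by omega), erase_extendSet S hi.1 hi.2, vS_of_subset (extendSet n _ _ _).2,
        map_smul, vS_of_subset (erase_erase_subset S i (-i)), extendMap_bv]
    · simp
  · have hmem : ((n : ℤ) + 1 ∈ Szero (extendSet n a b S).1 ∧
        -((n : ℤ) + 1) ∈ Szero (extendSet n a b S).1) ↔ a = true ∧ b = true := by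
      simp only [mem_Szero, neg_neg, succ_mem_extendSet, neg_succ_mem_extendSet]
      tauto
    simp only [hmem]
    split_ifs with h
    · obtain ⟨rfl, rfl⟩ := h
      rw [wLt_extendSet S le_rfl, erase_extendSet_last, vS_of_subset (extendSet n _ _ _).2,
        weightOp_bv, map_smul, extendMap_bv, one_mul]
    · rfl

lemma Fop_extendMap (n : ℕ) (a b : Bool) (h : ¬ (a = true ∧ b = true)) (x : Lam n) :
    Fop (n + 1) (extendMap n a b x) = extendMap n a b (Fop n x) := by
  suffices H : Fop (n + 1) ∘ₗ extendMap n a b = extendMap n a b ∘ₗ Fop n from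
    LinearMap.congr_fun H x
  refine end_ext fun S => ?_
  simp only [LinearMap.comp_apply, extendMap_bv, Fop_bv, FAct_extendSet, if_neg h, add_zero]

lemma Fop_extendMap_true (n : ℕ) (x : Lam n) :
    Fop (n + 1) (extendMap n true true x) =
      extendMap n true true (Fop n x) + extendMap n false false (weightOp n 1 x) := by
  suffices H : Fop (n + 1) ∘ₗ extendMap n true true =
      extendMap n true true ∘ₗ Fop n + extendMap n false false ∘ₗ weightOp n 1 from
    LinearMap.congr_fun H x
  refine end_ext fun S => ?_
  simp [extendMap_bv, Fop_bv, FAct_extendSet]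

lemma Fdiv_zero (n : ℕ) : Fdiv n 0 = 1 := by
  simp [Fdiv, qFact]

lemma Fop_Fdiv (n m : ℕ) (x : Lam n) :
    Fop n (Fdiv n m x) = qNum qv (m + 1) • Fdiv n (m + 1) x := by
  simp only [Fdiv, LinearMap.smul_apply, map_smul, pow_succ', Module.End.mul_apply, smul_smul,
    qFact_succ]
  congr 1
  have := qNum_ne_zero m
  have := qFact_ne_zero m
  field_simp

lemma Fdiv_succ (n m : ℕ) (x : Lam n) :
    Fdiv n (m + 1) x = (qNum qv (m + 1))⁻¹ • Fop n (Fdiv n m x) := by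
  rw [Fop_Fdiv, inv_smul_smul₀ (qNum_ne_zero m)]

lemma Fdiv_extendMap (n : ℕ) (a b : Bool) (h : ¬ (a = true ∧ b = true)) (m : ℕ) (x : Lam n) :
    Fdiv (n + 1) m (extendMap n a b x) = extendMap n a b (Fdiv n m x) := by
  induction m with
  | zero => simp [Fdiv_zero]
  | succ m ih => rw [Fdiv_succ, ih, Fop_extendMap n a b h, Fdiv_succ, map_smul]

lemma Fdiv_extendMap_true (n m : ℕ) (x : Lam n) :
    Fdiv (n + 1) (m + 1) (extendMap n true true x) =
      extendMap n true true (Fdiv n (m + 1) x) +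
        qv ^ (-m : ℤ) • extendMap n false false (weightOp n 1 (Fdiv n m x)) := by
  induction m with
  | zero =>
    have h1 : qNum qv 1 = 1 := by simp [qNum, div_self qv_sub_inv_ne_zero]
    simp [Fdiv_succ, Fdiv_zero, Fop_extendMap_true, h1]
  | succ m ih =>
    have h0 := qv_ne_zero
    have h1 := qNum_ne_zero (m + 1)
    have h2 : (-qv) ^ (-2 * (1 : ℤ)) = (qv ^ 2)⁻¹ := by
      rw [mul_one, Even.neg_zpow (by decide), zpow_neg]; rfl
    rw [Fdiv_succ (n + 1), ih, map_add, map_smul, Fop_extendMap_true,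
      Fop_extendMap n false false (by simp), Fop_weightOp, Fop_Fdiv n m, Fop_Fdiv n (m + 1), h2]
    simp only [map_smul, smul_add, smul_smul]
    rw [add_assoc, ← add_smul, inv_mul_cancel₀ h1, one_smul]
    congr 2
    have h3 := qNum_succ_succ m
    rw [show m + 1 + 1 = m + 2 from rfl] at h1 ⊢
    rw [← mul_one_add, inv_mul_eq_iff_eq_mul₀ h1, h3]
    push_cast
    rw [neg_add, zpow_add₀ h0, zpow_neg, zpow_natCast, zpow_neg_one]
    field_simp
    ring

lemma Fdiv_mem {n : ℕ} {k l : ℤ} {x : Lam n} (m : ℕ) (hx : x ∈ latticeDeg n k)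
    (hl : k = l + 2 * m) : Fdiv n m x ∈ latticeDeg n l := by
  induction n generalizing k l m with
  | zero =>
    cases m with
    | zero =>
      obtain rfl : k = l := by simpa using hl
      simpa [Fdiv_zero] using hx
    | succ m =>
      have : Fop 0 = 0 := end_ext fun S => by simp [Fop_bv, FAct]
      rw [Fdiv_succ, this]
      simp
  | succ n ih =>
    rw [sum_extendMap_compMap n x]
    simp only [map_add]
    refine add_mem (add_mem (add_mem ?_ ?_) ?_) ?_
    · rw [Fdiv_extendMap _ _ _ (by simp)]
      exact extendMap_mem (ih m (compMap_mem (k := k) hx (by simp)) hl) (by simp)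
    · have h1 := compMap_mem (n := n) (k := k - 2) (a := true) (b := true) hx (by simp; ring)
      cases m with
      | zero =>
        simpa [Fdiv_zero] using extendMap_mem h1 (by simp at hl ⊢; omega)
      | succ m =>
        push_cast at hl
        rw [Fdiv_extendMap_true]
        refine add_mem (extendMap_mem (ih (m + 1) h1 (l := l - 2) (by push_cast; omega))
          (by simp; ring)) (smul_mem_latticeDeg (qv_zpow_mem _) ?_)
        exact extendMap_mem (weightOp_mem 1 (ih m h1 (l := l) (by omega))) (by simp)
    · rw [Fdiv_extendMap _ _ _ (by simp)]
      exact extendMap_mem (ih m (compMap_mem (k := k - 1) hx (by simp)) (l := l - 1) (by omega))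
        (by simp)
    · rw [Fdiv_extendMap _ _ _ (by simp)]
      exact extendMap_mem (ih m (compMap_mem (k := k - 1) hx (by simp)) (l := l - 1) (by omega))
        (by simp)

/-- An integral homogeneous element of `ker F` lifts along `F^{(i)}`. -/
lemma exists_Fdiv_eq {n : ℕ} {k : ℤ} {y : Lam n} (i : ℕ) (hik : i + k ≤ n)
    (hy : y ∈ latticeDeg n k) (hF : Fop n y = 0) :
    ∃ x ∈ latticeDeg n (k + 2 * i), Fdiv n i x = y := by
  induction n generalizing k i with
  | zero =>
    cases i with
    | zero => exact ⟨y, by simpa using hy, by simp [Fdiv_zero]⟩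
    | succ i =>
      have h0 : y = 0 := by
        ext S
        exact (hy S).2 (by push_cast at hik; omega)
      exact ⟨0, zero_mem _, by simp [h0]⟩
  | succ n ih =>
    cases i with
    | zero => exact ⟨y, by simpa using hy, by simp [Fdiv_zero]⟩
    | succ j =>
    push_cast at hik
    have h00 := compMap_mem (n := n) (k := k) (a := false) (b := false) hy (by simp)
    have h11 := compMap_mem (n := n) (k := k - 2) (a := true) (b := true) hy (by simp; ring)
    have h01 := compMap_mem (n := n) (k := k - 1) (a := false) (b := true) hy (by simp)
    have h10 := compMap_mem (n := n) (k := k - 1) (a := true) (b := false) hy (by simp)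
    have hdec := sum_extendMap_compMap n y
    generalize compMap n false false y = y00 at *
    generalize compMap n true true y = y11 at *
    generalize compMap n false true y = y01 at *
    generalize compMap n true false y = y10 at *
    have hFc (a b : Bool) := congrArg (compMap n a b) hF
    rw [hdec] at hFc
    simp only [map_add, Fop_extendMap_true, Fop_extendMap n false false (by simp),
      Fop_extendMap n false true (by simp), Fop_extendMap n true false (by simp),
      compMap_extendMap, map_zero] at hFc
    have f11 : Fop n y11 = 0 := by simpa using hFc true true
    have f01 : Fop n y01 = 0 := by simpa using hFc false true
    have f10 : Fop n y10 = 0 := by simpa using hFc true false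
    obtain ⟨x01, m01, e01⟩ := ih (j + 1) (by push_cast; omega) h01 f01
    obtain ⟨x10, m10, e10⟩ := ih (j + 1) (by push_cast; omega) h10 f10
    obtain ⟨x11, m11, e11⟩ := ih (j + 1) (by push_cast; omega) h11 f11
    obtain ⟨z, mz, ez⟩ := ih (j + 2) (by push_cast; omega)
      (neg_mem (smul_mem_latticeDeg (qv_zpow_mem (-(j + 1 : ℕ))) (weightOp_mem 1 h11)))
      (by rw [map_neg, map_smul, Fop_weightOp, f11]; simp)
    have mu : extendMap n false false z + extendMap n true true x11 + extendMap n false true x01 +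
        extendMap n true false x10 ∈ latticeDeg (n + 1) (k + 2 * (j + 1 : ℕ)) := by
      refine add_mem (add_mem (add_mem (extendMap_mem mz ?_) (extendMap_mem m11 ?_))
        (extendMap_mem m01 ?_)) (extendMap_mem m10 ?_) <;> simp <;> ring
    set u := extendMap n false false z + extendMap n true true x11 + extendMap n false true x01 +
        extendMap n true false x10 with hu
    set r := y00 - Fdiv n (j + 1) z - qv ^ (-j : ℤ) • weightOp n 1 (Fdiv n j x11) with hr
    have hyu : y - Fdiv (n + 1) (j + 1) u = extendMap n false false r := by
      rw [hdec, hu, hr]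
      simp only [map_add, map_sub, map_smul, Fdiv_extendMap n false false (by simp),
        Fdiv_extendMap n false true (by simp), Fdiv_extendMap n true false (by simp),
        Fdiv_extendMap_true, e01, e10, e11]
      abel
    have hFu : Fop (n + 1) (Fdiv (n + 1) (j + 1) u) = 0 := by
      rw [Fop_Fdiv, hu]
      simp only [map_add, Fdiv_extendMap n false false (by simp),
        Fdiv_extendMap n false true (by simp), Fdiv_extendMap n true false (by simp),
        Fdiv_extendMap_true, e11, ez]
      rw [Fdiv_succ n (j + 1) x11, Fdiv_succ n (j + 1) x01, Fdiv_succ n (j + 1) x10, e11, e01, e10,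
        f11, f01, f10]
      simp
    have fr : Fop n r = 0 := by
      have h1 : Fop (n + 1) (extendMap n false false r) = 0 := by
        rw [← hyu, map_sub, hF, hFu, sub_zero]
      rw [Fop_extendMap n false false (by simp)] at h1
      simpa [compMap_extendMap] using congrArg (compMap n false false) h1
    have mr : r ∈ latticeDeg n k := by
      refine sub_mem (sub_mem h00 (Fdiv_mem (j + 1) mz (by push_cast; ring)))
        (smul_mem_latticeDeg (qv_zpow_mem _) (weightOp_mem 1 (Fdiv_mem j m11 ?_)))
      push_cast
      ring
    suffices H : ∃ x ∈ latticeDeg (n + 1) (k + 2 * (j + 1 : ℕ)),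
        Fdiv (n + 1) (j + 1) x = extendMap n false false r by
      obtain ⟨x, mx, ex⟩ := H
      exact ⟨u + x, add_mem mu mx, by rw [map_add, ex, ← hyu]; abel⟩
    by_cases hc : (j + 1 : ℕ) + k ≤ n
    · obtain ⟨x, mx, ex⟩ := ih (j + 1) hc mr fr
      exact ⟨extendMap n false false x, extendMap_mem mx (by simp),
        by rw [Fdiv_extendMap n false false (by simp), ex]⟩
    · obtain ⟨x, mx, ex⟩ := ih j (by omega)
        (smul_mem_latticeDeg (qv_zpow_mem j) (weightOp_mem (-1) mr))
        (by rw [map_smul, Fop_weightOp, fr]; simp)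
      refine ⟨extendMap n true true x, extendMap_mem mx (by simp; ring), ?_⟩
      rw [Fdiv_extendMap_true, Fdiv_succ, ex]
      simp only [map_smul, Fop_weightOp, fr, map_zero, smul_zero, zero_add, weightOp_neg, smul_smul]
      rw [← zpow_add₀ qv_ne_zero]
      simp

/-- F^{(i)} maps ker(F^{(i+1)}) ∩ Λ_A^k into ker(F) ∩ Λ_A^{k−2i},
surjectively (stated as an image equality). -/
theorem stmt10 (n : ℕ) (hn : 1 ≤ n) (k i : ℕ) (hk : k ≤ n) (hki : 2 * i ≤ k) :
    (Fdiv n i) '' {x : Lam n | (Fdiv n (i + 1)) x = 0 ∧ x ∈ LamA n ∧ x ∈ Lk n k} =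
      {x : Lam n | Fop n x = 0 ∧ x ∈ LamA n ∧ x ∈ Lk n (k - 2 * i)} := by
  simp only [← mem_latticeDeg_iff]
  ext y
  constructor
  · rintro ⟨x, ⟨h1, h2⟩, rfl⟩
    exact ⟨by rw [Fop_Fdiv, h1, smul_zero], Fdiv_mem i h2 (by omega)⟩
  · rintro ⟨h1, h2⟩
    obtain ⟨x, mx, ex⟩ := exists_Fdiv_eq i (by omega) h2 h1
    refine ⟨x, ⟨?_, ?_⟩, ex⟩
    · rw [Fdiv_succ, ex, h1, smul_zero]
    · rwa [show (k : ℤ) = (k - 2 * i : ℕ) + 2 * i by omega]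

end
end

section
/- Let k ∈ {0,…,n} and let j_1,…,j_r and l_1,…,l_s be sequences of elements of {1,…,n} such that both iterated applications ff_{j_1}(ff_{j_2}(⋯ ff_{j_r}({1,…,k}) ⋯)) and ff_{l_1}(ff_{l_2}(⋯ ff_{l_s}({1,…,k}) ⋯)) are defined at every step and produce the same subset S ⊆ I. Then the multisets {j_1,…,j_r} and {l_1,…,l_s} coincide; in particular r = s (so the length ℓ(S) := r is well defined). -/
/-- The partial crystal operator `ff_i` on subsets of `I` (`none` = undefined). -/
def ffOp (n : ℕ) (i : ℤ) (S : Finset ℤ) : Option (Finset ℤ) :=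
  if 1 ≤ i ∧ i < (n : ℤ) then
    (if S ∩ quad i = {i} ∨ S ∩ quad i = ({i, -i} : Finset ℤ) ∨
        S ∩ quad i = ({i, -(i + 1), -i} : Finset ℤ) then
      some (insert (i + 1) (S.erase i))
     else if S ∩ quad i = {-(i + 1)} ∨ S ∩ quad i = ({i, -(i + 1)} : Finset ℤ) ∨
        S ∩ quad i = ({i + 1, -(i + 1)} : Finset ℤ) ∨
        S ∩ quad i = ({i, i + 1, -(i + 1)} : Finset ℤ) then
      some (insert (-i) (S.erase (-(i + 1))))
     else none)
  else if i = (n : ℤ) then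
    (if (n : ℤ) ∈ S ∧ -(n : ℤ) ∉ S then some (insert (-(n : ℤ)) (S.erase (n : ℤ))) else none)
  else none

/-- Iterated application `ff_{j_1}(ff_{j_2}(⋯ ff_{j_r}(S) ⋯))` for a list `l = [j_1,…,j_r]`;
the result is `none` if any step is undefined. -/
def applyFF (n : ℕ) (l : List ℤ) (S : Finset ℤ) : Option (Finset ℤ) :=
  l.foldr (fun j acc => acc.bind (ffOp n j)) (some S)

/-- The number of `ff_m` steps on the way from `1` up to `x` in
`1 < 2 < ⋯ < n < −n < ⋯ < −1`. -/
def stepCount (n : ℕ) (m x : ℤ) : ℤ :=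
  if x < 0 then (if m < n ∧ -x ≤ m then 2 else 1) else if m < x then 1 else 0

theorem sum_insert_erase_of_mem {α M : Type*} [DecidableEq α] [AddCommGroup M] (f : α → M)
    {S : Finset α} {a b : α} (ha : a ∈ S) (hb : b ∉ S) :
    ∑ x ∈ insert b (S.erase a), f x = ∑ x ∈ S, f x + (f b - f a) := by
  rw [Finset.sum_insert (fun h => hb (Finset.mem_of_mem_erase h)), Finset.sum_erase_eq_sub ha]
  abel

theorem mem_iff_of_inter_quad_eq {i : ℤ} {S T : Finset ℤ} (h : S ∩ quad i = T) {x : ℤ}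
    (hx : x ∈ quad i) : x ∈ S ↔ x ∈ T := by
  rw [← h, Finset.mem_inter, and_iff_left hx]

/-- Every defined step `ff_i` moves one element `a` of `S` to the next letter `b` along an arrow
labelled `i`. -/
theorem exists_move_of_ffOp_eq_some {n : ℕ} {i : ℤ} {S T : Finset ℤ} (h : ffOp n i S = some T) :
    ∃ a b, a ∈ S ∧ b ∉ S ∧ T = insert b (S.erase a) ∧
      ((1 ≤ i ∧ i < n ∧ a = i ∧ b = i + 1) ∨ (1 ≤ i ∧ i < n ∧ a = -(i + 1) ∧ b = -i) ∨
        (i = n ∧ a = n ∧ b = -n)) := by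
  unfold ffOp at h
  split_ifs at h with hi hA hB hn hC
  · refine ⟨i, i + 1, ?_, ?_, (Option.some.inj h).symm, Or.inl ⟨hi.1, hi.2, rfl, rfl⟩⟩
    · rcases hA with hA | hA | hA <;>
        simp [mem_iff_of_inter_quad_eq hA (x := i) (by simp [quad])]
    · rcases hA with hA | hA | hA <;>
        rw [mem_iff_of_inter_quad_eq hA (by simp [quad])] <;>
        simp only [Finset.mem_insert, Finset.mem_singleton] <;> omega
  · refine ⟨-(i + 1), -i, ?_, ?_, (Option.some.inj h).symm,
      Or.inr (Or.inl ⟨hi.1, hi.2, rfl, rfl⟩)⟩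
    · rcases hB with hB | hB | hB | hB <;>
        rw [mem_iff_of_inter_quad_eq hB (by simp [quad])] <;> simp
    · rcases hB with hB | hB | hB | hB <;>
        rw [mem_iff_of_inter_quad_eq hB (by simp [quad])] <;>
        simp only [Finset.mem_insert, Finset.mem_singleton] <;> omega
  · exact ⟨n, -n, hC.1, hC.2, (Option.some.inj h).symm, Or.inr (Or.inr ⟨hn, rfl, rfl⟩)⟩

theorem sum_stepCount_of_ffOp_eq_some {n : ℕ} {i m : ℤ} {S T : Finset ℤ} (hm : 1 ≤ m)
    (hmn : m ≤ n) (h : ffOp n i S = some T) :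
    ∑ x ∈ T, stepCount n m x = ∑ x ∈ S, stepCount n m x + if i = m then 1 else 0 := by
  obtain ⟨a, b, ha, hb, rfl, hab⟩ := exists_move_of_ffOp_eq_some h
  rw [sum_insert_erase_of_mem _ ha hb]
  congr 1
  unfold stepCount
  split_ifs <;> omega

theorem sum_stepCount_of_applyFF_eq_some {n : ℕ} {m : ℤ} {S : Finset ℤ} (hm : 1 ≤ m)
    (hmn : m ≤ n) (l : List ℤ) {T : Finset ℤ} (h : applyFF n l S = some T) :
    ∑ x ∈ T, stepCount n m x = ∑ x ∈ S, stepCount n m x + l.count m := by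
  induction l generalizing T with
  | nil =>
    obtain rfl : S = T := Option.some.inj h
    simp
  | cons j l ih =>
    obtain ⟨U, hU, hT⟩ := Option.bind_eq_some_iff.mp h
    rw [sum_stepCount_of_ffOp_eq_some hm hmn hT, ih hU, List.count_cons]
    simp only [beq_iff_eq]
    push_cast
    ring

/-- two sequences of crystal operators taking {1,…,k} to the same subset S,
with every step defined, have the same underlying multiset of indices; in particular the
length ℓ(S) is well defined. -/
theorem stmt15 (n : ℕ) (hn : 1 ≤ n) (k : ℕ) (hk : k ≤ n) (l1 l2 : List ℤ)
    (h1mem : ∀ j ∈ l1, j ∈ Finset.Icc (1 : ℤ) (n : ℤ))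
    (h2mem : ∀ j ∈ l2, j ∈ Finset.Icc (1 : ℤ) (n : ℤ))
    (S : Finset ℤ)
    (h1 : applyFF n l1 (Finset.Icc (1 : ℤ) (k : ℤ)) = some S)
    (h2 : applyFF n l2 (Finset.Icc (1 : ℤ) (k : ℤ)) = some S) :
    (l1 : Multiset ℤ) = (l2 : Multiset ℤ) ∧ l1.length = l2.length := by
  have hperm : l1.Perm l2 := by
    refine List.perm_iff_count.mpr fun m => ?_
    by_cases hm : m ∈ Finset.Icc (1 : ℤ) n
    · obtain ⟨hm1, hmn⟩ := Finset.mem_Icc.mp hm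
      have e1 := sum_stepCount_of_applyFF_eq_some hm1 hmn l1 h1
      have e2 := sum_stepCount_of_applyFF_eq_some hm1 hmn l2 h2
      omega
    · rw [List.count_eq_zero_of_not_mem fun h => hm (h1mem m h),
        List.count_eq_zero_of_not_mem fun h => hm (h2mem m h)]
  exact ⟨Multiset.coe_eq_coe.mpr hperm, hperm.length_eq⟩
end

section
/- For every i ∈ {1,…,n−1} and every S ⊆ I the following hold: f_i·b_S = b_{(S∖{i})∪{i+1}} if S_{i,i+1} = {i}; f_i·b_S = b_{(S∖{−(i+1)})∪{−i}} if S_{i,i+1} = {−(i+1)}; f_i·b_S = b_{(S∖{−(i+1)})∪{−i}} if S_{i,i+1} = {i,−(i+1)}; f_i·b_S = (q + q⁻¹)·b_{(S∖{i})∪{i+1}} if S_{i,i+1} = {i,−i}; f_i·b_S = b_{(S∖{−(i+1)})∪{−i}} if S_{i,i+1} = {i+1,−(i+1)}; f_i·b_S = b_{(S∖{i})∪{i+1}} if S_{i,i+1} = {i,−(i+1),−i}; f_i·b_S = b_{(S∖{−(i+1)})∪{−i}} if S_{i,i+1} = {i,i+1,−(i+1)}. Moreover f_n·b_S = b_{(S∖{n})∪{−n}}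 whenever n ∈ S and −n ∉ S. -/
noncomputable section

/-- One step of the matching algorithm at column `x`, acting on the pair
(partial assignment, set `U` of unmatched undotted columns). -/
def stepCol (S : Finset ℤ) (x : ℤ) (p : (ℤ → ℤ) × Finset ℤ) : (ℤ → ℤ) × Finset ℤ :=
  if x ∈ S ∧ -x ∈ S then
    (if hU : p.2.Nonempty then
      (Function.update p.1 x (p.2.min' hU), p.2.erase (p.2.min' hU))
     else (Function.update p.1 x x, p.2))
  else if x ∉ S ∧ -x ∉ S then (p.1, insert x p.2)
  else p

/-- Running the matching algorithm over the columns `n, n−1, …, 1`. -/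
def matchData (n : ℕ) (S : Finset ℤ) : (ℤ → ℤ) × Finset ℤ :=
  ((List.range n).map (fun t => (n : ℤ) - t)).foldl (fun p x => stepCol S x p) (id, ∅)

/-- The matching `x ↦ x^S`. -/
def matchCol (n : ℕ) (S : Finset ℤ) (x : ℤ) : ℤ := (matchData n S).1 x

/-- `L(S)`: fully dotted columns matched to an undotted column. -/
def LSet (n : ℕ) (S : Finset ℤ) : Finset ℤ :=
  (Finset.Icc (1 : ℤ) (n : ℤ)).filter (fun x => x ∈ S ∧ -x ∈ S ∧ matchCol n S x ≠ x)

/-- `±X`. -/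
def pmSet (X : Finset ℤ) : Finset ℤ := X ∪ negSet X

/-- The canonical basis vector `b_S`. -/
def bvecL (n : ℕ) (S : Finset ℤ) : Lam n :=
  ∑ X ∈ (LSet n S).powerset,
    (qv ^ (-(X.card : ℤ))) • vS n ((S \ pmSet X) ∪ pmSet (X.image (matchCol n S)))


/-! ### One step of the matching algorithm -/

/-- Column `x` is fully dotted. -/
abbrev Dotted (S : Finset ℤ) (x : ℤ) : Prop := x ∈ S ∧ -x ∈ S

/-- Column `x` is undotted. -/
abbrev Undotted (S : Finset ℤ) (x : ℤ) : Prop := x ∉ S ∧ -x ∉ S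

theorem stepCol_single {S : Finset ℤ} {x : ℤ} (p : (ℤ → ℤ) × Finset ℤ)
    (h₁ : ¬Dotted S x) (h₂ : ¬Undotted S x) : stepCol S x p = p := by
  simp only [stepCol, if_neg h₁, if_neg h₂]

theorem stepCol_undotted {S : Finset ℤ} {x : ℤ} (p : (ℤ → ℤ) × Finset ℤ)
    (h : Undotted S x) : stepCol S x p = (p.1, insert x p.2) := by
  have h₁ : ¬Dotted S x := fun h' => h.1 h'.1
  simp only [stepCol, if_neg h₁, if_pos h]

theorem stepCol_dotted_of_isLeast {S : Finset ℤ} {x u : ℤ} {p : (ℤ → ℤ) × Finset ℤ}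
    (h : Dotted S x) (hu : IsLeast (p.2 : Set ℤ) u) :
    stepCol S x p = (Function.update p.1 x u, p.2.erase u) := by
  have hne : p.2.Nonempty := ⟨u, hu.1⟩
  have hmin : p.2.min' hne = u := (p.2.isLeast_min' hne).unique hu
  simp only [stepCol, if_pos h, dif_pos hne, hmin]

theorem stepCol_dotted_of_empty {S : Finset ℤ} {x : ℤ} {p : (ℤ → ℤ) × Finset ℤ}
    (h : Dotted S x) (hp : p.2 = ∅) (hx : p.1 x = x) : stepCol S x p = p := by
  have hne : ¬p.2.Nonempty := by simp [hp]
  have hup : Function.update p.1 x x = p.1 := by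
    rw [Function.update_eq_self_iff, hx]
  simp only [stepCol, if_pos h, dif_neg hne, hup]

/-- A step depends on `S` only through the type of the column. -/
theorem stepCol_congr {S S' : Finset ℤ} {x : ℤ} (p : (ℤ → ℤ) × Finset ℤ)
    (hd : Dotted S' x ↔ Dotted S x) (hu : Undotted S' x ↔ Undotted S x) :
    stepCol S' x p = stepCol S x p := by
  simp only [stepCol, hd, hu]

theorem empty_or_exists_isLeast (U : Finset ℤ) : U = ∅ ∨ ∃ u, IsLeast (U : Set ℤ) u := by
  rcases U.eq_empty_or_nonempty with h | h
  · exact Or.inl h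
  · exact Or.inr ⟨_, U.isLeast_min' h⟩

/-! ### States of the matching algorithm -/

/-- The state of the matching algorithm after processing the `k` largest columns. -/
def matchState (n : ℕ) (S : Finset ℤ) (k : ℕ) : (ℤ → ℤ) × Finset ℤ :=
  ((List.range k).map (fun t : ℕ => (n : ℤ) - t)).foldl (fun p x => stepCol S x p) (id, ∅)

theorem matchState_succ (n : ℕ) (S : Finset ℤ) (k : ℕ) :
    matchState n S (k + 1) = stepCol S ((n : ℤ) - k) (matchState n S k) := by
  simp [matchState, List.range_succ]

theorem matchCol_eq (n : ℕ) (S : Finset ℤ) : matchCol n S = (matchState n S n).1 := by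
  have h : matchData n S = matchState n S n := by
    simp [matchData, matchState, ← List.map_eq_flatMap, Function.comp_def]
  funext x
  rw [matchCol, h]

/-- The invariants of the matching algorithm once all columns above `b` are processed. -/
structure MatchInv (n : ℕ) (S : Finset ℤ) (b : ℤ) (p : (ℤ → ℤ) × Finset ℤ) : Prop where
  free : ∀ u ∈ p.2, b < u ∧ u ≤ n ∧ Undotted S u
  moved : ∀ z, p.1 z ≠ z →
    b < z ∧ Dotted S z ∧ z < p.1 z ∧ p.1 z ≤ n ∧ Undotted S (p.1 z) ∧ p.1 z ∉ p.2

theorem matchInv_matchState (n : ℕ) (S : Finset ℤ) (k : ℕ) :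
    MatchInv n S ((n : ℤ) - k) (matchState n S k) := by
  induction k with
  | zero => constructor <;> simp [matchState]
  | succ k ih =>
    rw [matchState_succ]
    set p := matchState n S k
    set x : ℤ := (n : ℤ) - k with hx
    have hb : (n : ℤ) - (k + 1 : ℕ) = x - 1 := by push_cast; omega
    have hxn : x ≤ n := by omega
    rw [hb]
    have hfree := ih.free
    have hmoved := ih.moved
    by_cases hd : Dotted S x
    · have hfix : p.1 x = x := by
        by_contra h
        exact absurd (hmoved x h).1 (lt_irrefl _)
      rcases empty_or_exists_isLeast p.2 with he | ⟨u, hu⟩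
      · rw [stepCol_dotted_of_empty hd he hfix]
        refine ⟨fun u hu => ?_, fun z hz => ?_⟩
        · simp [he] at hu
        · have := hmoved z hz
          exact ⟨by omega, this.2⟩
      · rw [stepCol_dotted_of_isLeast hd hu]
        have huU : u ∈ p.2 := hu.1
        have hfu := hfree u huU
        refine ⟨fun v hv => ?_, fun z hz => ?_⟩
        · have := hfree v (Finset.mem_of_mem_erase hv)
          exact ⟨by omega, this.2⟩
        · by_cases hzx : z = x
          · subst hzx
            simp only [Function.update_self]
            exact ⟨by omega, hd, hfu.1, hfu.2.1, hfu.2.2, by simp⟩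
          · simp only [Function.update_of_ne hzx] at hz ⊢
            have := hmoved z hz
            exact ⟨by omega, this.2.1, this.2.2.1, this.2.2.2.1, this.2.2.2.2.1,
              fun h => this.2.2.2.2.2 (Finset.mem_of_mem_erase h)⟩
    · by_cases hud : Undotted S x
      · rw [stepCol_undotted _ hud]
        refine ⟨fun u hu => ?_, fun z hz => ?_⟩
        · rcases Finset.mem_insert.1 hu with rfl | hu
          · exact ⟨by omega, hxn, hud⟩
          · have := hfree u hu
            exact ⟨by omega, this.2⟩
        · have := hmoved z hz
          refine ⟨by omega, this.2.1, this.2.2.1, this.2.2.2.1, this.2.2.2.2.1, ?_⟩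
          simp only [Finset.mem_insert, not_or]
          exact ⟨by change p.1 z ≠ x; omega, this.2.2.2.2.2⟩
      · rw [stepCol_single _ hd hud]
        refine ⟨fun u hu => ?_, fun z hz => ?_⟩
        · have := hfree u hu
          exact ⟨by omega, this.2⟩
        · have := hmoved z hz
          exact ⟨by omega, this.2⟩

theorem MatchInv.fixed {n : ℕ} {S : Finset ℤ} {b : ℤ} {p : (ℤ → ℤ) × Finset ℤ}
    (h : MatchInv n S b p) {z : ℤ} (hz : z ≤ b ∨ ¬Dotted S z) : p.1 z = z := by
  by_contra hne
  have := h.moved z hne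
  rcases hz with hz | hz
  · omega
  · exact hz this.2.1

theorem matchState_congr {n : ℕ} {S S' : Finset ℤ} {k : ℕ}
    (h : ∀ x : ℤ, (n : ℤ) - k < x →
      (Dotted S' x ↔ Dotted S x) ∧ (Undotted S' x ↔ Undotted S x)) :
    matchState n S' k = matchState n S k := by
  induction k with
  | zero => rfl
  | succ k ih =>
    rw [matchState_succ, matchState_succ,
      ih fun x hx => h x (by push_cast; omega)]
    have := h ((n : ℤ) - k) (by push_cast; omega)
    exact stepCol_congr _ this.1 this.2

theorem matchInv_matchCol (n : ℕ) (S : Finset ℤ) :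
    MatchInv n S 0 (matchCol n S, (matchState n S n).2) := by
  simpa [matchCol_eq] using matchInv_matchState n S n

theorem mem_LSet {n : ℕ} {S : Finset ℤ} {x : ℤ} : x ∈ LSet n S ↔ matchCol n S x ≠ x := by
  simp only [LSet, Finset.mem_filter, Finset.mem_Icc]
  refine ⟨fun h => h.2.2.2, fun h => ?_⟩
  have := (matchInv_matchCol n S).moved x h
  simp only at this
  exact ⟨⟨by omega, by omega⟩, this.2.1.1, this.2.1.2, h⟩

/-- Propagate a relation between two runs of the algorithm through the lower columns. -/
theorem matchState_rel_of_step {n : ℕ} {S S' : Finset ℤ} {a : ℕ}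
    (R : (ℤ → ℤ) × Finset ℤ → (ℤ → ℤ) × Finset ℤ → Prop)
    (h₀ : R (matchState n S a) (matchState n S' a))
    (hstep : ∀ (x : ℤ) (p p' : (ℤ → ℤ) × Finset ℤ), 0 < x → x ≤ (n : ℤ) - a →
      MatchInv n S x p → MatchInv n S' x p' → R p p' →
      R (stepCol S x p) (stepCol S' x p'))
    (han : a ≤ n) :
    R (matchState n S n) (matchState n S' n) := by
  suffices ∀ d, a + d ≤ n → R (matchState n S (a + d)) (matchState n S' (a + d)) by
    simpa [Nat.add_sub_cancel' han] using this (n - a) (by omega)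
  intro d
  induction d with
  | zero => exact fun _ => h₀
  | succ d ih =>
    intro hd
    rw [← add_assoc, matchState_succ, matchState_succ]
    exact hstep _ _ _ (by push_cast; omega) (by push_cast; omega)
      (matchInv_matchState n S (a + d)) (matchInv_matchState n S' (a + d)) (ih (by omega))

/-! ### Exchanging two adjacent columns -/

/-- The signed permutation of `ℤ` exchanging the columns `i` and `i + 1`. -/
def swapCol (i z : ℤ) : ℤ :=
  if z = i then i + 1 else if z = i + 1 then i
  else if z = -i then -(i + 1) else if z = -(i + 1) then -i else z

theorem swapCol_swapCol {i : ℤ} (hi : 0 < i) (z : ℤ) : swapCol i (swapCol i z) = z := by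
  unfold swapCol; split_ifs <;> omega

theorem swapCol_neg {i : ℤ} (hi : 0 < i) (z : ℤ) : swapCol i (-z) = -swapCol i z := by
  unfold swapCol; split_ifs <;> omega

theorem swapCol_injective {i : ℤ} (hi : 0 < i) : Function.Injective (swapCol i) :=
  Function.LeftInverse.injective (swapCol_swapCol hi)

theorem mem_image_swapCol {i : ℤ} (hi : 0 < i) {S : Finset ℤ} {z : ℤ} :
    z ∈ S.image (swapCol i) ↔ swapCol i z ∈ S := by
  refine ⟨fun h => ?_, fun h => Finset.mem_image.2 ⟨_, h, swapCol_swapCol hi z⟩⟩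
  obtain ⟨w, hw, rfl⟩ := Finset.mem_image.1 h
  rwa [swapCol_swapCol hi]

theorem dotted_image_swapCol {i : ℤ} (hi : 0 < i) {S : Finset ℤ} {z : ℤ} :
    Dotted (S.image (swapCol i)) z ↔ Dotted S (swapCol i z) := by
  simp only [Dotted, mem_image_swapCol hi, swapCol_neg hi]

theorem undotted_image_swapCol {i : ℤ} (hi : 0 < i) {S : Finset ℤ} {z : ℤ} :
    Undotted (S.image (swapCol i)) z ↔ Undotted S (swapCol i z) := by
  simp only [Undotted, mem_image_swapCol hi, swapCol_neg hi]

/-- Two states correspond to each other under exchanging the columns `i` and `i + 1`. -/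
def SwapRel (i : ℤ) (p p' : (ℤ → ℤ) × Finset ℤ) : Prop :=
  (∀ z, p'.1 (swapCol i z) = swapCol i (p.1 z)) ∧ p'.2 = p.2.image (swapCol i)

theorem SwapRel.stepCol {i : ℤ} (hi : 0 < i) {S : Finset ℤ} {p p' : (ℤ → ℤ) × Finset ℤ}
    {x : ℤ} (h : SwapRel i p p') (hx : p.1 x = x) (hpos : ∀ u ∈ p.2, 0 < u)
    (hU : i ∈ p.2 → i + 1 ∉ p.2) :
    SwapRel i (stepCol S x p) (stepCol (S.image (swapCol i)) (swapCol i x) p') := by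
  have hdot := dotted_image_swapCol hi (S := S) (z := swapCol i x)
  have hundot := undotted_image_swapCol hi (S := S) (z := swapCol i x)
  rw [swapCol_swapCol hi] at hdot hundot
  by_cases hd : Dotted S x
  · have hd' := hdot.2 hd
    rcases empty_or_exists_isLeast p.2 with he | ⟨u, hu⟩
    · rw [stepCol_dotted_of_empty hd he hx,
        stepCol_dotted_of_empty hd' (by simp [h.2, he]) (by rw [h.1, hx])]
      exact h
    · have hu' : IsLeast (p'.2 : Set ℤ) (swapCol i u) := by
        have huU : u ∈ p.2 := hu.1
        rw [h.2]
        refine ⟨by simpa using ⟨u, huU, rfl⟩, fun v hv => ?_⟩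
        obtain ⟨w, hw, rfl⟩ := Finset.mem_image.1 (Finset.mem_coe.1 hv)
        have hle : u ≤ w := hu.2 hw
        have h₁ := hpos u huU
        have h₂ := hpos w hw
        have h₃ : ¬(u = i ∧ w = i + 1) := fun ⟨h₄, h₅⟩ => hU (h₄ ▸ huU) (h₅ ▸ hw)
        unfold swapCol; split_ifs <;> omega
      rw [stepCol_dotted_of_isLeast hd hu, stepCol_dotted_of_isLeast hd' hu']
      refine ⟨fun z => ?_, ?_⟩
      · by_cases hz : z = x
        · simp [hz]
        · have : swapCol i z ≠ swapCol i x := fun h' => hz (swapCol_injective hi h')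
          simp only [Function.update_of_ne hz, Function.update_of_ne this, h.1]
      · simp only [h.2, Finset.image_erase (swapCol_injective hi)]
  · by_cases hud : Undotted S x
    · rw [stepCol_undotted _ hud, stepCol_undotted _ (hundot.2 hud)]
      exact ⟨h.1, by simp only [h.2, Finset.image_insert]⟩
    · rw [stepCol_single _ hd hud, stepCol_single _ (mt hdot.1 hd) (mt hundot.1 hud)]
      exact h

/-- After all columns above `i + 1`, the algorithm has not touched the columns `i`, `i + 1`. -/
theorem MatchInv.swapRel_self {n : ℕ} {S : Finset ℤ} {i : ℤ} {p : (ℤ → ℤ) × Finset ℤ}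
    (hi : 0 < i) (h : MatchInv n S (i + 1) p) : SwapRel i p p := by
  refine ⟨fun z => ?_, ?_⟩
  · by_cases hz : p.1 z = z
    · rw [hz]
      by_cases hs : swapCol i z = z
      · rw [hs, hz]
      · refine h.fixed (Or.inl ?_)
        revert hs
        unfold swapCol; split_ifs <;> omega
    · have := h.moved z hz
      have h₁ : swapCol i z = z := by unfold swapCol; split_ifs <;> omega
      have h₂ : swapCol i (p.1 z) = p.1 z := by unfold swapCol; split_ifs <;> omega
      rw [h₁, h₂]
  · have : ∀ u ∈ p.2, swapCol i u = u := fun u hu => by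
      have := h.free u hu
      unfold swapCol; split_ifs <;> omega
    rw [Finset.image_congr (g := id) (fun u hu => this u hu), Finset.image_id]

theorem swapCol_of_lt {i x : ℤ} (h₀ : 0 < x) (h : x < i) : swapCol i x = x := by
  unfold swapCol; split_ifs <;> omega

theorem swapCol_left (i : ℤ) : swapCol i i = i + 1 := by simp [swapCol]

theorem swapCol_right (i : ℤ) : swapCol i (i + 1) = i := by simp [swapCol]

/-- If one of the columns `i`, `i + 1` carries a single dot, then exchanging the columns
exchanges the matching. -/
theorem matchCol_image_swapCol {n : ℕ} {S : Finset ℤ} {i : ℤ} (hi : 0 < i) (hin : i < n)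
    (hS : ¬Dotted S i ∧ ¬Undotted S i ∨ ¬Dotted S (i + 1) ∧ ¬Undotted S (i + 1)) (z : ℤ) :
    matchCol n (S.image (swapCol i)) (swapCol i z) = swapCol i (matchCol n S z) := by
  obtain ⟨a, ha⟩ : ∃ a : ℕ, (n : ℤ) - a = i + 1 := ⟨(n - (i + 1)).toNat, by omega⟩
  have ha' : (n : ℤ) - (a + 1 : ℕ) = i := by push_cast; omega
  set S' := S.image (swapCol i) with hS'
  have hd := fun z => dotted_image_swapCol hi (S := S) (z := z)
  have hu := fun z => undotted_image_swapCol hi (S := S) (z := z)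
  have hinv := matchInv_matchState n S a
  rw [ha] at hinv
  have hstart : matchState n S' a = matchState n S a := matchState_congr fun x hx => by
    have : swapCol i x = x := by unfold swapCol; split_ifs <;> omega
    rw [hd, hu, this]
    exact ⟨Iff.rfl, Iff.rfl⟩
  have hself := hinv.swapRel_self hi
  have hbase : SwapRel i (matchState n S (a + 2)) (matchState n S' (a + 2)) := by
    rw [matchState_succ, matchState_succ, matchState_succ, matchState_succ, hstart, ha, ha']
    have hpos : ∀ u ∈ (matchState n S a).2, 0 < u := fun u hu => by
      have := hinv.free u hu; omega
    have hne : i ∈ (matchState n S a).2 → i + 1 ∉ (matchState n S a).2 := fun h => by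
      have := hinv.free i h; omega
    rcases hS with ⟨h₁, h₂⟩ | ⟨h₁, h₂⟩
    · rw [stepCol_single _ h₁ h₂, stepCol_single (S := S') (x := i + 1) _
        (by rwa [hd, swapCol_right]) (by rwa [hu, swapCol_right])]
      simpa only [swapCol_right] using
        hself.stepCol hi (S := S) (x := i + 1) (hinv.fixed (by omega)) hpos hne
    · rw [stepCol_single (S := S) (x := i + 1) _ h₁ h₂, stepCol_single (S := S') (x := i) _
        (by rwa [hd, swapCol_left]) (by rwa [hu, swapCol_left])]
      simpa only [swapCol_left] using
        hself.stepCol hi (S := S) (x := i) (hinv.fixed (by omega)) hpos hne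
  have := matchState_rel_of_step (SwapRel i) hbase (fun x p p' hx₀ hx hp hp' hR => by
    have h := hR.stepCol hi (S := S) (x := x) (hp.fixed (by omega))
      (fun u hu => by have := hp.free u hu; omega)
      (fun h₁ h₂ => by
        have := (hp.free _ h₁).2.2
        have := (hp.free _ h₂).2.2
        tauto)
    rwa [swapCol_of_lt hx₀ (by push_cast at hx; omega)] at h) (by omega)
  rw [matchCol_eq, matchCol_eq]
  exact this.1 z

/-! ### A dotted column directly below an undotted one -/

theorem matchCol_of_dotted_undotted {n : ℕ} {S T : Finset ℤ} {i : ℤ} (hi : 0 < i)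
    (hin : i < n) (hTi : Dotted T i) (hTi' : Undotted T (i + 1))
    (hSi : ¬Dotted S i ∧ ¬Undotted S i) (hSi' : ¬Dotted S (i + 1) ∧ ¬Undotted S (i + 1))
    (hST : ∀ x, 0 < x → x ≠ i → x ≠ i + 1 →
      (Dotted T x ↔ Dotted S x) ∧ (Undotted T x ↔ Undotted S x)) :
    matchCol n T = Function.update (matchCol n S) i (i + 1) := by
  obtain ⟨a, ha⟩ : ∃ a : ℕ, (n : ℤ) - a = i + 1 := ⟨(n - (i + 1)).toNat, by omega⟩
  have ha' : (n : ℤ) - (a + 1 : ℕ) = i := by push_cast; omega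
  have hinv := matchInv_matchState n S a
  rw [ha] at hinv
  have hstart : matchState n T a = matchState n S a :=
    matchState_congr fun x hx => hST x (by omega) (by omega) (by omega)
  have hnot : i + 1 ∉ (matchState n S a).2 := fun h => by have := hinv.free _ h; omega
  have hleast : IsLeast ((insert (i + 1) (matchState n S a).2 : Finset ℤ) : Set ℤ) (i + 1) := by
    refine ⟨by simp, fun v hv => ?_⟩
    rcases Finset.mem_insert.1 (Finset.mem_coe.1 hv) with rfl | hv
    · exact le_rfl
    · have := hinv.free v hv; omega
  have hbase : (matchState n T (a + 2)).1 =
      Function.update (matchState n S (a + 2)).1 i (i + 1) ∧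
      (matchState n T (a + 2)).2 = (matchState n S (a + 2)).2 := by
    rw [matchState_succ, matchState_succ, matchState_succ, matchState_succ, hstart, ha, ha',
      stepCol_single _ hSi'.1 hSi'.2, stepCol_single _ hSi.1 hSi.2,
      stepCol_undotted _ hTi', stepCol_dotted_of_isLeast hTi hleast]
    exact ⟨rfl, Finset.erase_insert hnot⟩
  have := matchState_rel_of_step
    (fun p p' => p.1 = Function.update p'.1 i (i + 1) ∧ p.2 = p'.2) hbase
    (fun x p p' hx₀ hx hp hp' hR => by
      have hxi : x < i := by push_cast at hx; omega
      obtain ⟨hxd, hxu⟩ := hST x hx₀ (by omega) (by omega)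
      obtain ⟨h₁, h₂⟩ := hR
      by_cases hd : Dotted T x
      · rcases empty_or_exists_isLeast p'.2 with he | ⟨u, hu⟩
        · rw [stepCol_dotted_of_empty hd (h₂.trans he) (hp.fixed (by omega)),
            stepCol_dotted_of_empty (hxd.1 hd) he (hp'.fixed (by omega))]
          exact ⟨h₁, h₂⟩
        · rw [stepCol_dotted_of_isLeast hd (h₂ ▸ hu),
            stepCol_dotted_of_isLeast (hxd.1 hd) hu]
          exact ⟨by simp only [h₁]; rw [Function.update_comm hxi.ne], by simp only [h₂]⟩
      · by_cases hu : Undotted T x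
        · rw [stepCol_undotted _ hu, stepCol_undotted _ (hxu.1 hu)]
          exact ⟨h₁, by simp only [h₂]⟩
        · rw [stepCol_single _ hd hu, stepCol_single _ (mt hxd.2 hd) (mt hxu.2 hu)]
          exact ⟨h₁, h₂⟩) (by omega)
  rw [matchCol_eq, matchCol_eq]
  exact this.1

/-! ### An undotted column directly below a dotted one -/

/-- If the dotted column `i + 1` above the undotted column `i` is matched to `y`, then replacing
both columns by columns with a single dot makes `y` take over the role of `i`. -/
def MatchedRel (i y : ℤ) (p p' : (ℤ → ℤ) × Finset ℤ) : Prop :=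
  p.1 (i + 1) = y ∧ i + 1 < y ∧ y ∉ p.2 ∧ (i ∈ p.2 → ∀ u ∈ p.2, u ≤ i ∨ y < u) ∧
  (∀ z, p'.1 z = if z = i + 1 then z else if p.1 z = i ∧ z ≠ i then y else p.1 z) ∧
  p'.2 = p.2.image (fun u => if u = i then y else u)

/-- If the dotted column `i + 1` above the undotted column `i` is unmatched, then replacing
both columns by columns with a single dot makes the column matched to `i` unmatched. -/
def UnmatchedRel (i : ℤ) (p p' : (ℤ → ℤ) × Finset ℤ) : Prop :=
  p.1 (i + 1) = i + 1 ∧ (i ∈ p.2 → ∀ u ∈ p.2, u ≤ i) ∧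
  (∀ z, p'.1 z = if p.1 z = i then z else p.1 z) ∧ p'.2 = p.2.erase i

theorem MatchedRel.stepCol {i y x : ℤ} {S S' : Finset ℤ} {p p' : (ℤ → ℤ) × Finset ℤ}
    (h : MatchedRel i y p p') (hx : x < i) (hd : Dotted S' x ↔ Dotted S x)
    (hu : Undotted S' x ↔ Undotted S x) (hpx : p.1 x = x) (hpx' : p'.1 x = x) :
    MatchedRel i y (stepCol S x p) (stepCol S' x p') := by
  obtain ⟨hy, hiy, hyU, hU, hm, hU'⟩ := h
  by_cases hdx : Dotted S x
  · rcases empty_or_exists_isLeast p.2 with he | ⟨u, hul⟩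
    · rw [stepCol_dotted_of_empty hdx he hpx,
        stepCol_dotted_of_empty (hd.2 hdx) (by simp [hU', he]) hpx']
      exact ⟨hy, hiy, hyU, hU, hm, hU'⟩
    · have huU : u ∈ p.2 := hul.1
      have hul' : IsLeast (p'.2 : Set ℤ) (if u = i then y else u) := by
        rw [hU']
        refine ⟨by simpa using ⟨u, huU, rfl⟩, fun v hv => ?_⟩
        obtain ⟨w, hw, rfl⟩ := Finset.mem_image.1 (Finset.mem_coe.1 hv)
        have hle : u ≤ w := hul.2 hw
        have h₁ : u = i → w ≤ i ∨ y < w := fun h => hU (h ▸ huU) w hw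
        have h₂ : w = i → u ≤ i ∨ y < u := fun h => hU (h ▸ hw) u huU
        split_ifs <;> omega
      rw [stepCol_dotted_of_isLeast hdx hul, stepCol_dotted_of_isLeast (hd.2 hdx) hul']
      refine ⟨?_, hiy, fun h => hyU (Finset.mem_of_mem_erase h), fun h₁ v hv =>
        hU (Finset.mem_of_mem_erase h₁) v (Finset.mem_of_mem_erase hv), fun z => ?_, ?_⟩
      · simp only [Function.update_of_ne (show i + 1 ≠ x by omega), hy]
      · by_cases hz : z = x
        · subst hz
          simp only [Function.update_self]
          split_ifs <;> first | rfl | omega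
        · simp only [Function.update_of_ne hz, hm]
      · ext v
        simp only [hU', Finset.mem_erase, Finset.mem_image]
        constructor
        · rintro ⟨hne, w, hw, rfl⟩
          exact ⟨w, ⟨fun h => hne (by rw [h]), hw⟩, rfl⟩
        · rintro ⟨w, ⟨hne, hw⟩, rfl⟩
          refine ⟨fun h => ?_, w, hw, rfl⟩
          have h₁ : w ≠ y := fun h => hyU (h ▸ hw)
          have h₂ : u ≠ y := fun h => hyU (h ▸ huU)
          split_ifs at h <;> omega
  · by_cases hux : Undotted S x
    · rw [stepCol_undotted _ hux, stepCol_undotted _ (hu.2 hux)]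
      refine ⟨hy, hiy, ?_, fun h₁ v hv => ?_, hm, ?_⟩
      · simp only [Finset.mem_insert, not_or]
        exact ⟨by omega, hyU⟩
      · simp only [Finset.mem_insert] at h₁ hv
        rcases hv with rfl | hv
        · left; omega
        · exact hU (h₁.resolve_left (by omega)) v hv
      · simp only [hU', Finset.image_insert, if_neg hx.ne]
    · rw [stepCol_single _ hdx hux, stepCol_single _ (mt hd.1 hdx) (mt hu.1 hux)]
      exact ⟨hy, hiy, hyU, hU, hm, hU'⟩

theorem UnmatchedRel.stepCol {i x : ℤ} {S S' : Finset ℤ} {p p' : (ℤ → ℤ) × Finset ℤ}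
    (h : UnmatchedRel i p p') (hx : x < i) (hd : Dotted S' x ↔ Dotted S x)
    (hu : Undotted S' x ↔ Undotted S x) (hpx : p.1 x = x) (hpx' : p'.1 x = x) :
    UnmatchedRel i (stepCol S x p) (stepCol S' x p') := by
  obtain ⟨hy, hU, hm, hU'⟩ := h
  by_cases hdx : Dotted S x
  · rcases empty_or_exists_isLeast p.2 with he | ⟨u, hul⟩
    · rw [stepCol_dotted_of_empty hdx he hpx,
        stepCol_dotted_of_empty (hd.2 hdx) (by simp [hU', he]) hpx']
      exact ⟨hy, hU, hm, hU'⟩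
    · have huU : u ∈ p.2 := hul.1
      rw [stepCol_dotted_of_isLeast hdx hul]
      have hy' : Function.update p.1 x u (i + 1) = i + 1 := by
        rw [Function.update_of_ne (by omega), hy]
      have hUe : i ∈ p.2.erase u → ∀ v ∈ p.2.erase u, v ≤ i := fun h₁ v hv =>
        hU (Finset.mem_of_mem_erase h₁) v (Finset.mem_of_mem_erase hv)
      by_cases hui : u = i
      · subst hui
        have he : p'.2 = ∅ := by
          rw [hU', Finset.eq_empty_iff_forall_notMem]
          intro v hv
          have h₁ := hU huU v (Finset.mem_of_mem_erase hv)
          have h₂ : u ≤ v := hul.2 (Finset.mem_of_mem_erase hv)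
          exact Finset.ne_of_mem_erase hv (le_antisymm h₁ h₂)
        rw [stepCol_dotted_of_empty (hd.2 hdx) he hpx']
        refine ⟨hy', hUe, fun z => ?_, ?_⟩
        · by_cases hz : z = x
          · subst hz
            simp [hpx']
          · simp only [Function.update_of_ne hz, hm]
        · simp only [hU', Finset.erase_idem]
      · have hul' : IsLeast (p'.2 : Set ℤ) u := by
          rw [hU']
          exact ⟨by simpa using ⟨huU, hui⟩, fun v hv =>
            hul.2 (Finset.mem_of_mem_erase (Finset.mem_coe.1 hv))⟩
        rw [stepCol_dotted_of_isLeast (hd.2 hdx) hul']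
        refine ⟨hy', hUe, fun z => ?_, ?_⟩
        · by_cases hz : z = x
          · subst hz
            simp [hui]
          · simp only [Function.update_of_ne hz, hm]
        · simp only [hU', Finset.erase_right_comm]
  · by_cases hux : Undotted S x
    · rw [stepCol_undotted _ hux, stepCol_undotted _ (hu.2 hux)]
      refine ⟨hy, fun h₁ v hv => ?_, hm, ?_⟩
      · simp only [Finset.mem_insert] at h₁ hv
        rcases hv with rfl | hv
        · omega
        · exact hU (h₁.resolve_left (by omega)) v hv
      · simp only [hU', Finset.erase_insert_of_ne hx.ne]
    · rw [stepCol_single _ hdx hux, stepCol_single _ (mt hd.1 hdx) (mt hu.1 hux)]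
      exact ⟨hy, hU, hm, hU'⟩

theorem matchCol_of_undotted_dotted {n : ℕ} {S S' : Finset ℤ} {i : ℤ} (hi : 0 < i)
    (hin : i < n) (hSi : Undotted S i) (hSi' : Dotted S (i + 1))
    (hSi₁ : ¬Dotted S' i ∧ ¬Undotted S' i)
    (hSi₁' : ¬Dotted S' (i + 1) ∧ ¬Undotted S' (i + 1))
    (hSS : ∀ x, 0 < x → x ≠ i → x ≠ i + 1 →
      (Dotted S' x ↔ Dotted S x) ∧ (Undotted S' x ↔ Undotted S x)) :
    (∃ y, MatchedRel i y (matchState n S n) (matchState n S' n)) ∨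
      UnmatchedRel i (matchState n S n) (matchState n S' n) := by
  obtain ⟨a, ha⟩ : ∃ a : ℕ, (n : ℤ) - a = i + 1 := ⟨(n - (i + 1)).toNat, by omega⟩
  have ha' : (n : ℤ) - (a + 1 : ℕ) = i := by push_cast; omega
  have hinv := matchInv_matchState n S a
  rw [ha] at hinv
  have hstart : matchState n S' a = matchState n S a :=
    matchState_congr fun x hx => hSS x (by omega) (by omega) (by omega)
  have hS₂ : matchState n S (a + 2) = ((stepCol S (i + 1) (matchState n S a)).1,
      insert i (stepCol S (i + 1) (matchState n S a)).2) := by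
    rw [matchState_succ, matchState_succ, ha, ha', stepCol_undotted _ hSi]
  have hS₂' : matchState n S' (a + 2) = matchState n S a := by
    rw [matchState_succ, matchState_succ, ha, ha', stepCol_single _ hSi₁.1 hSi₁.2,
      stepCol_single _ hSi₁'.1 hSi₁'.2, hstart]
  set p := matchState n S a
  have hfix : p.1 (i + 1) = i + 1 := hinv.fixed (by omega)
  have hne : ∀ z, p.1 z = i → z = i := fun z hz => by
    by_contra h
    have := hinv.moved z (by omega)
    omega
  have hnot : i ∉ p.2 := fun h => by have := hinv.free i h; omega
  rcases empty_or_exists_isLeast p.2 with he | ⟨y, hy⟩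
  · right
    refine matchState_rel_of_step (a := a + 2) _ ?_ (fun x p p' hx₀ hx hp hp' hR => ?_)
      (by omega)
    · rw [hS₂, hS₂', stepCol_dotted_of_empty hSi' he hfix]
      refine ⟨hfix, fun _ u hu => ?_, fun z => ?_, ?_⟩
      · simp [he] at hu; omega
      · by_cases hz : p.1 z = i
        · rw [if_pos hz, hne z hz, hinv.fixed (by omega)]
        · rw [if_neg hz]
      · simp [he]
    · have hxi : x < i := by push_cast at hx; omega
      have := hSS x hx₀ (by omega) (by omega)
      exact hR.stepCol hxi this.1 this.2 (hp.fixed (by omega)) (hp'.fixed (by omega))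
  · left
    have hyU : y ∈ p.2 := hy.1
    have hyi := hinv.free y hyU
    refine ⟨y, matchState_rel_of_step (a := a + 2) _ ?_ (fun x p p' hx₀ hx hp hp' hR => ?_)
      (by omega)⟩
    · rw [hS₂, hS₂', stepCol_dotted_of_isLeast hSi' hy]
      refine ⟨by simp, by omega, ?_, fun _ u hu => ?_, fun z => ?_, ?_⟩
      · simp only [Finset.mem_insert, Finset.mem_erase, not_or]
        exact ⟨by omega, by simp⟩
      · simp only [Finset.mem_insert, Finset.mem_erase] at hu
        rcases hu with rfl | ⟨hne, hu⟩
        · exact Or.inl le_rfl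
        · have : y ≤ u := hy.2 hu
          omega
      · by_cases hz : z = i + 1
        · rw [if_pos hz, hz, hfix]
        · simp only [Function.update_of_ne hz, if_neg hz]
          rw [if_neg fun h => h.2 (hne z h.1)]
      · simp only [Finset.image_insert, if_pos]
        rw [Finset.image_congr (g := id), Finset.image_id, Finset.insert_erase hyU]
        intro u hu
        have : u ≠ i := fun h => hnot (h ▸ Finset.mem_of_mem_erase (Finset.mem_coe.1 hu))
        simp [this]
    · have hxi : x < i := by push_cast at hx; omega
      have := hSS x hx₀ (by omega) (by omega)
      exact hR.stepCol hxi this.1 this.2 (hp.fixed (by omega)) (hp'.fixed (by omega))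

/-! ### The operators `f_i` on standard basis vectors -/

theorem fop_vS {n : ℕ} (i : ℤ) {T : Finset ℤ} (hT : T ⊆ Iset n) :
    fop n i (vS n T) = fAct n i T := by
  simp [fop, mkOp, vS, hT, Finsupp.linearCombination_single]

theorem inter_quad_eq_iff {i : ℤ} {S B : Finset ℤ} (hB : B ⊆ quad i) :
    S ∩ quad i = B ↔ (i ∈ S ↔ i ∈ B) ∧ (i + 1 ∈ S ↔ i + 1 ∈ B) ∧ (-i ∈ S ↔ -i ∈ B) ∧
      (-(i + 1) ∈ S ↔ -(i + 1) ∈ B) := by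
  constructor
  · rintro rfl
    simp [quad]
  · rintro ⟨h₁, h₂, h₃, h₄⟩
    ext z
    rw [Finset.mem_inter]
    constructor
    · rintro ⟨hz, hq⟩
      simp only [quad, Finset.mem_insert, Finset.mem_singleton] at hq
      rcases hq with rfl | rfl | rfl | rfl <;> tauto
    · intro hz
      have hq := hB hz
      refine ⟨?_, hq⟩
      simp only [quad, Finset.mem_insert, Finset.mem_singleton] at hq
      rcases hq with rfl | rfl | rfl | rfl <;> tauto

section quad

variable {n : ℕ} {i : ℤ} {S : Finset ℤ}

theorem inter_quad_eq_left (hi : 0 < i) : S ∩ quad i = {i} ↔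
    i ∈ S ∧ i + 1 ∉ S ∧ -i ∉ S ∧ -(i + 1) ∉ S := by
  rw [inter_quad_eq_iff (by simp [quad])]
  grind

theorem inter_quad_eq_neg_right (hi : 0 < i) : S ∩ quad i = {-(i + 1)} ↔
    i ∉ S ∧ i + 1 ∉ S ∧ -i ∉ S ∧ -(i + 1) ∈ S := by
  rw [inter_quad_eq_iff (by simp [quad])]
  grind

theorem inter_quad_eq_left_neg_right (hi : 0 < i) : S ∩ quad i = {i, -(i + 1)} ↔
    i ∈ S ∧ i + 1 ∉ S ∧ -i ∉ S ∧ -(i + 1) ∈ S := by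
  rw [inter_quad_eq_iff (by simp [quad, Finset.insert_subset_iff])]
  grind

theorem inter_quad_eq_left_neg_left : S ∩ quad i = {i, -i} ↔
    i ∈ S ∧ i + 1 ∉ S ∧ -i ∈ S ∧ -(i + 1) ∉ S := by
  rw [inter_quad_eq_iff (by simp [quad, Finset.insert_subset_iff])]
  grind

theorem inter_quad_eq_right_neg_right : S ∩ quad i = {i + 1, -(i + 1)} ↔
    i ∉ S ∧ i + 1 ∈ S ∧ -i ∉ S ∧ -(i + 1) ∈ S := by
  rw [inter_quad_eq_iff (by simp [quad, Finset.insert_subset_iff])]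
  grind

theorem inter_quad_eq_left_neg_right_neg_left (hi : 0 < i) :
    S ∩ quad i = {i, -(i + 1), -i} ↔ i ∈ S ∧ i + 1 ∉ S ∧ -i ∈ S ∧ -(i + 1) ∈ S := by
  rw [inter_quad_eq_iff (by simp [quad, Finset.insert_subset_iff])]
  grind

theorem inter_quad_eq_left_right_neg_right (hi : 0 < i) :
    S ∩ quad i = {i, i + 1, -(i + 1)} ↔ i ∈ S ∧ i + 1 ∈ S ∧ -i ∉ S ∧ -(i + 1) ∈ S := by
  rw [inter_quad_eq_iff (by simp [quad, Finset.insert_subset_iff])]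
  grind

theorem fAct_of_lt (hi : 0 < i) (hin : i < n) : fAct n i S =
    if i ∈ S ∧ i + 1 ∉ S ∧ -i ∉ S ∧ -(i + 1) ∉ S then vS n (insert (i + 1) (S.erase i))
    else if i ∉ S ∧ i + 1 ∉ S ∧ -i ∉ S ∧ -(i + 1) ∈ S then
      vS n (insert (-i) (S.erase (-(i + 1))))
    else if i ∈ S ∧ i + 1 ∉ S ∧ -i ∉ S ∧ -(i + 1) ∈ S then
      vS n (insert (-i) (S.erase (-(i + 1)))) + qv⁻¹ • vS n (insert (i + 1) (S.erase i))
    else if i ∈ S ∧ i + 1 ∉ S ∧ -i ∈ S ∧ -(i + 1) ∉ S then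
      qv • vS n (insert (i + 1) (S.erase i))
    else if i ∉ S ∧ i + 1 ∈ S ∧ -i ∉ S ∧ -(i + 1) ∈ S then
      vS n (insert (-i) (S.erase (-(i + 1))))
    else if i ∈ S ∧ i + 1 ∉ S ∧ -i ∈ S ∧ -(i + 1) ∈ S then vS n (insert (i + 1) (S.erase i))
    else if i ∈ S ∧ i + 1 ∈ S ∧ -i ∉ S ∧ -(i + 1) ∈ S then
      vS n (insert (-i) (S.erase (-(i + 1))))
    else 0 := by
  simp only [fAct, if_neg hin.ne, inter_quad_eq_left hi, inter_quad_eq_neg_right hi,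
    inter_quad_eq_left_neg_right hi, inter_quad_eq_left_neg_left,
    inter_quad_eq_right_neg_right, inter_quad_eq_left_neg_right_neg_left hi,
    inter_quad_eq_left_right_neg_right hi]

theorem image_swapCol_eq_left (hi : 0 < i) (h₁ : i ∈ S)
    (h₂ : -i ∉ S ∧ i + 1 ∉ S ∧ -(i + 1) ∉ S ∨ -i ∈ S ∧ i + 1 ∉ S ∧ -(i + 1) ∈ S) :
    insert (i + 1) (S.erase i) = S.image (swapCol i) := by
  ext z
  rw [mem_image_swapCol hi]
  simp only [Finset.mem_insert, Finset.mem_erase]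
  unfold swapCol
  grind

theorem image_swapCol_eq_right (hi : 0 < i) (h₁ : -(i + 1) ∈ S)
    (h₂ : i ∉ S ∧ i + 1 ∉ S ∧ -i ∉ S ∨ i ∈ S ∧ i + 1 ∈ S ∧ -i ∉ S) :
    insert (-i) (S.erase (-(i + 1))) = S.image (swapCol i) := by
  ext z
  rw [mem_image_swapCol hi]
  simp only [Finset.mem_insert, Finset.mem_erase]
  unfold swapCol
  grind

theorem fAct_eq_swap (hi : 0 < i) (hin : i < n)
    (hS : i ∈ S ∧ -i ∉ S ∧ (i + 1 ∈ S ↔ -(i + 1) ∈ S) ∨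
      -(i + 1) ∈ S ∧ i + 1 ∉ S ∧ (i ∈ S ↔ -i ∈ S)) :
    fAct n i S = vS n (S.image (swapCol i)) := by
  rw [fAct_of_lt hi hin]
  by_cases h₁ : i ∈ S <;> by_cases h₂ : i + 1 ∈ S <;> by_cases h₃ : -i ∈ S <;>
    by_cases h₄ : -(i + 1) ∈ S <;> simp only [h₁, h₂, h₃, h₄] at hS ⊢ <;>
    simp [-neg_add_rev] at hS ⊢ <;>
    first
    | rw [image_swapCol_eq_left hi h₁ (by tauto)]
    | rw [image_swapCol_eq_right hi h₄ (by tauto)]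

end quad

/-! ### The terms of `b_S` -/

theorem mem_pmSet {X : Finset ℤ} {z : ℤ} : z ∈ pmSet X ↔ z ∈ X ∨ -z ∈ X := by
  simp only [pmSet, negSet, Finset.mem_union, Finset.mem_image]
  refine or_congr_right ⟨?_, fun h => ⟨-z, h, neg_neg z⟩⟩
  rintro ⟨w, hw, rfl⟩
  rwa [neg_neg]

/-- The set obtained from `S` by removing `±X` and adding `±Y`. -/
def exchange (S X Y : Finset ℤ) : Finset ℤ := (S \ pmSet X) ∪ pmSet Y

theorem mem_exchange {S X Y : Finset ℤ} {z : ℤ} :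
    z ∈ exchange S X Y ↔ z ∈ S ∧ z ∉ X ∧ -z ∉ X ∨ z ∈ Y ∨ -z ∈ Y := by
  simp only [exchange, Finset.mem_union, Finset.mem_sdiff, mem_pmSet, not_or]

theorem bvecL_eq (n : ℕ) (S : Finset ℤ) : bvecL n S = ∑ X ∈ (LSet n S).powerset,
    (qv⁻¹ ^ X.card) • vS n (exchange S X (X.image (matchCol n S))) := by
  simp only [bvecL, exchange, zpow_neg, zpow_natCast, inv_pow]

theorem dotted_of_mem_LSet {n : ℕ} {S : Finset ℤ} {z : ℤ} (h : z ∈ LSet n S) :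
    0 < z ∧ z ≤ n ∧ Dotted S z := by
  have := (matchInv_matchCol n S).moved z (mem_LSet.1 h)
  exact ⟨this.1, by have := this.2; simp only at this; omega, this.2.1⟩

theorem undotted_matchCol {n : ℕ} {S : Finset ℤ} {z : ℤ} (h : z ∈ LSet n S) :
    0 < matchCol n S z ∧ matchCol n S z ≤ n ∧ Undotted S (matchCol n S z) := by
  have := (matchInv_matchCol n S).moved z (mem_LSet.1 h)
  simp only at this
  exact ⟨by omega, by omega, this.2.2.2.2.1⟩

theorem undotted_of_mem_image {n : ℕ} {S X : Finset ℤ} (hX : X ⊆ LSet n S) {y : ℤ}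
    (hy : y ∈ X.image (matchCol n S)) : 0 < y ∧ y ≤ n ∧ Undotted S y := by
  obtain ⟨z, hz, rfl⟩ := Finset.mem_image.1 hy
  exact undotted_matchCol (hX hz)

theorem exchange_subset {n : ℕ} {S X : Finset ℤ} (hS : S ⊆ Iset n) (hX : X ⊆ LSet n S) :
    exchange S X (X.image (matchCol n S)) ⊆ Iset n := by
  intro z hz
  rcases mem_exchange.1 hz with h | h | h
  · exact hS h.1
  all_goals
    have := undotted_of_mem_image hX h
    simp only [Iset, Finset.mem_erase, Finset.mem_Icc]
    omega

theorem fop_bvecL {n : ℕ} (i : ℤ) {S : Finset ℤ} (hS : S ⊆ Iset n) :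
    fop n i (bvecL n S) = ∑ X ∈ (LSet n S).powerset,
      (qv⁻¹ ^ X.card) • fAct n i (exchange S X (X.image (matchCol n S))) := by
  rw [bvecL_eq, map_sum]
  refine Finset.sum_congr rfl fun X hX => ?_
  rw [map_smul, fop_vS i (exchange_subset hS (Finset.mem_powerset.1 hX))]

theorem image_swapCol_exchange {i : ℤ} (hi : 0 < i) (S X Y : Finset ℤ) :
    (exchange S X Y).image (swapCol i) =
      exchange (S.image (swapCol i)) (X.image (swapCol i)) (Y.image (swapCol i)) := by
  ext z
  simp only [mem_image_swapCol hi, mem_exchange, swapCol_neg hi]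

/-- A pair of column dots not involved in an exchange can be moved before or after it. -/
theorem exchange_replace {S X Y : Finset ℤ} {a b : ℤ} (haY : a ∉ Y ∧ -a ∉ Y)
    (hbX : b ∉ X ∧ -b ∉ X) :
    insert b ((exchange S X Y).erase a) = exchange (insert b (S.erase a)) X Y := by
  ext z
  simp only [Finset.mem_insert, Finset.mem_erase, mem_exchange]
  grind

section terms

variable {n : ℕ} {S X : Finset ℤ}

theorem mem_exchange_of_single (hX : X ⊆ LSet n S) {z : ℤ} (h₁ : ¬Dotted S z)
    (h₂ : ¬Undotted S z) : z ∈ exchange S X (X.image (matchCol n S)) ↔ z ∈ S := by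
  have hX₁ : ∀ w ∈ X, Dotted S w := fun w hw => (dotted_of_mem_LSet (hX hw)).2.2
  have hY₁ := fun w => undotted_of_mem_image hX (y := w)
  rw [mem_exchange]
  grind

theorem mem_exchange_neg_iff {Y : Finset ℤ} {z : ℤ} (h : z ∈ S ↔ -z ∈ S) :
    z ∈ exchange S X Y ↔ -z ∈ exchange S X Y := by
  simp only [mem_exchange, neg_neg]
  tauto

end terms

section cases

variable {n : ℕ} {i : ℤ} {S : Finset ℤ}

theorem fop_bvecL_swap (hi : 0 < i) (hin : i < n) (hI : S ⊆ Iset n)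
    (hS : i ∈ S ∧ -i ∉ S ∧ (i + 1 ∈ S ↔ -(i + 1) ∈ S) ∨
      -(i + 1) ∈ S ∧ i + 1 ∉ S ∧ (i ∈ S ↔ -i ∈ S)) :
    fop n i (bvecL n S) = bvecL n (S.image (swapCol i)) := by
  have hm := matchCol_image_swapCol hi hin (S := S) (by simp only [Dotted, Undotted]; tauto)
  have hL : ∀ z, z ∈ LSet n (S.image (swapCol i)) ↔ swapCol i z ∈ LSet n S := fun z => by
    have := hm (swapCol i z)
    rw [swapCol_swapCol hi] at this
    rw [mem_LSet, mem_LSet, this, ne_eq, ne_eq, not_iff_not]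
    refine ⟨fun h => ?_, fun h => by rw [h, swapCol_swapCol hi]⟩
    simpa only [swapCol_swapCol hi] using congrArg (swapCol i) h
  have hinv : ∀ X : Finset ℤ, (X.image (swapCol i)).image (swapCol i) = X := fun X => by
    ext z
    rw [mem_image_swapCol hi, mem_image_swapCol hi, swapCol_swapCol hi]
  rw [fop_bvecL i hI, bvecL_eq]
  refine Finset.sum_nbij' (fun X => X.image (swapCol i)) (fun X => X.image (swapCol i))
    (fun X hX => ?_) (fun X hX => ?_) (fun X _ => hinv X) (fun X _ => hinv X) (fun X hX => ?_)
  · rw [Finset.mem_powerset] at hX ⊢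
    intro z hz
    exact (hL z).2 (hX ((mem_image_swapCol hi).1 hz))
  · rw [Finset.mem_powerset] at hX ⊢
    intro z hz
    have := (hL _).1 (hX ((mem_image_swapCol hi).1 hz))
    rwa [swapCol_swapCol hi] at this
  · rw [Finset.mem_powerset] at hX
    rw [Finset.card_image_of_injective _ (swapCol_injective hi), fAct_eq_swap hi hin,
      image_swapCol_exchange hi]
    · simp only [Finset.image_image, Function.comp_def, hm]
    · rcases hS with ⟨h₁, h₂, h₃⟩ | ⟨h₁, h₂, h₃⟩
      · left
        rw [mem_exchange_of_single hX (z := i) (by simp [h₂]) (by simp [h₁]),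
          mem_exchange_of_single hX (z := -i) (by simp [h₂]) (by simp [h₁])]
        exact ⟨h₁, h₂, mem_exchange_neg_iff h₃⟩
      · right
        rw [mem_exchange_of_single hX (z := i + 1) (fun h => h₂ h.1) (fun h => h.2 h₁),
          mem_exchange_of_single hX (z := -(i + 1)) (fun h => h₂ (neg_neg (i + 1) ▸ h.2))
            (fun h => h.1 h₁)]
        exact ⟨h₁, h₂, mem_exchange_neg_iff h₃⟩

/-- The canonical basis vector of a set with a dotted column `i` below an undotted column
`i + 1`, in terms of the matching of a set with single dots in these columns. -/
theorem bvecL_of_dotted_undotted {T : Finset ℤ} (hi : 0 < i) (hin : i < n)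
    (hTi : Dotted T i) (hTi' : Undotted T (i + 1))
    (hSi : ¬Dotted S i ∧ ¬Undotted S i) (hSi' : ¬Dotted S (i + 1) ∧ ¬Undotted S (i + 1))
    (hST : ∀ x, 0 < x → x ≠ i → x ≠ i + 1 →
      (Dotted T x ↔ Dotted S x) ∧ (Undotted T x ↔ Undotted S x)) :
    LSet n T = insert i (LSet n S) ∧ ∀ g : Finset ℤ → Finset ℤ → Lam n,
      ∑ X ∈ (LSet n T).powerset, (qv⁻¹ ^ X.card) • g X (X.image (matchCol n T)) =
      ∑ X ∈ (LSet n S).powerset, (qv⁻¹ ^ X.card) • (g X (X.image (matchCol n S)) +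
        qv⁻¹ • g (insert i X) (insert (i + 1) (X.image (matchCol n S)))) := by
  have hm := matchCol_of_dotted_undotted hi hin hTi hTi' hSi hSi' hST
  have hiL : i ∉ LSet n S := fun h => hSi.1 (dotted_of_mem_LSet h).2.2
  have hL : LSet n T = insert i (LSet n S) := by
    ext z
    by_cases hz : z = i
    · simp [hz, mem_LSet, hm]
    · simp [hz, mem_LSet, hm]
  refine ⟨hL, fun g => ?_⟩
  rw [hL, Finset.sum_powerset_insert hiL, ← Finset.sum_add_distrib]
  refine Finset.sum_congr rfl fun X hX => ?_
  have hiX : i ∉ X := fun h => hiL (Finset.mem_powerset.1 hX h)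
  have himg : X.image (matchCol n T) = X.image (matchCol n S) :=
    Finset.image_congr fun z hz => by
      have hzi : z ≠ i := fun h => hiX (h ▸ Finset.mem_coe.1 hz)
      rw [hm, Function.update_of_ne hzi]
  have hmi : matchCol n T i = i + 1 := by simp [hm]
  rw [Finset.image_insert, himg, hmi, Finset.card_insert_of_notMem hiX, smul_add, smul_smul,
    pow_succ]

theorem fop_bvecL_left_neg_right (hi : 0 < i) (hin : i < n) (hI : S ⊆ Iset n)
    (hS : i ∈ S ∧ i + 1 ∉ S ∧ -i ∉ S ∧ -(i + 1) ∈ S) :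
    fop n i (bvecL n S) = bvecL n (insert (-i) (S.erase (-(i + 1)))) := by
  obtain ⟨h₁, h₂, h₃, h₄⟩ := hS
  set T := insert (-i) (S.erase (-(i + 1))) with hT
  have hmT : ∀ z, z ∈ T ↔ z = -i ∨ z ≠ -(i + 1) ∧ z ∈ S := by simp [T]
  have hSi : ¬Dotted S i ∧ ¬Undotted S i := by grind
  have hSi' : ¬Dotted S (i + 1) ∧ ¬Undotted S (i + 1) := by grind
  rw [fop_bvecL i hI, bvecL_eq, (bvecL_of_dotted_undotted hi hin (S := S) (T := T)
    (by grind) (by grind) hSi hSi' (by grind)).2 fun X Y => vS n (exchange T X Y)]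
  refine Finset.sum_congr rfl fun X hX => ?_
  rw [Finset.mem_powerset] at hX
  have hXd := fun z (hz : z ∈ X) => dotted_of_mem_LSet (hX hz)
  have hYu := fun y => undotted_of_mem_image hX (y := y)
  have hsingle := fun z => mem_exchange_of_single hX (z := z)
  set Y := X.image (matchCol n S)
  rw [fAct_of_lt hi hin, if_neg, if_neg, if_pos, exchange_replace, ← hT]
  · congr 4
    ext z
    simp only [Finset.mem_insert, Finset.mem_erase, mem_exchange, hmT]
    grind
  all_goals grind

theorem fop_bvecL_left_neg_left (hi : 0 < i) (hin : i < n) (hI : S ⊆ Iset n)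
    (hS : i ∈ S ∧ i + 1 ∉ S ∧ -i ∈ S ∧ -(i + 1) ∉ S) :
    fop n i (bvecL n S) = (qv + qv⁻¹) • bvecL n (insert (i + 1) (S.erase i)) := by
  obtain ⟨h₁, h₂, h₃, h₄⟩ := hS
  set T := insert (i + 1) (S.erase i) with hT
  have hmT : ∀ z, z ∈ T ↔ z = i + 1 ∨ z ≠ i ∧ z ∈ S := by simp [T]
  have hTi : ¬Dotted T i ∧ ¬Undotted T i := by grind
  have hTi' : ¬Dotted T (i + 1) ∧ ¬Undotted T (i + 1) := by grind
  rw [fop_bvecL i hI, bvecL_eq, (bvecL_of_dotted_undotted hi hin (S := T) (T := S)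
    (by grind) (by grind) hTi hTi' (by grind)).2 fun X Y => fAct n i (exchange S X Y),
    Finset.smul_sum]
  refine Finset.sum_congr rfl fun X hX => ?_
  rw [Finset.mem_powerset] at hX
  have hXd := fun z (hz : z ∈ X) => dotted_of_mem_LSet (hX hz)
  have hYu := fun y => undotted_of_mem_image hX (y := y)
  set Y := X.image (matchCol n T)
  have hfst : fAct n i (exchange S X Y) = qv • vS n (exchange T X Y) := by
    rw [fAct_of_lt hi hin, if_neg, if_neg, if_neg, if_pos, exchange_replace, ← hT]
    all_goals grind [mem_exchange]
  have hsnd : fAct n i (exchange S (insert i X) (insert (i + 1) Y)) =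
      vS n (exchange T X Y) := by
    rw [fAct_of_lt hi hin, if_neg, if_neg, if_neg, if_neg, if_pos]
    · congr 1
      ext z
      simp only [Finset.mem_insert, Finset.mem_erase, mem_exchange, hmT]
      grind
    all_goals grind [mem_exchange]
  rw [hfst, hsnd, ← add_smul, smul_comm]

theorem fop_bvecL_top (hI : S ⊆ Iset n) (hn : 0 < n) (h₁ : (n : ℤ) ∈ S) (h₂ : -(n : ℤ) ∉ S) :
    fop n n (bvecL n S) = bvecL n (insert (-(n : ℤ)) (S.erase n)) := by
  set T := insert (-(n : ℤ)) (S.erase n) with hT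
  have hmT : ∀ z, z ∈ T ↔ z = -n ∨ z ≠ n ∧ z ∈ S := by simp [T]
  have hm : matchCol n T = matchCol n S := by
    rw [matchCol_eq, matchCol_eq, matchState_congr]
    intro x hx
    by_cases hxn : x = n
    · grind
    · grind
  have hL : LSet n T = LSet n S := by
    ext z
    rw [mem_LSet, mem_LSet, hm]
  rw [fop_bvecL n hI, bvecL_eq, hL, hm]
  refine Finset.sum_congr rfl fun X hX => ?_
  rw [Finset.mem_powerset] at hX
  have hXd := fun z (hz : z ∈ X) => dotted_of_mem_LSet (hX hz)
  have hYu := fun y => undotted_of_mem_image hX (y := y)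
  have hsingle := fun z => mem_exchange_of_single hX (z := z)
  rw [fAct, if_pos rfl, if_pos, exchange_replace, ← hT]
  all_goals grind

/-- How the matching changes when a dotted column `i + 1` and an undotted column `i` are
replaced by columns with single dots. -/
theorem matchCol_merge {T : Finset ℤ} (hi : 0 < i) (hin : i < n) (hSi : Undotted S i)
    (hSi' : Dotted S (i + 1)) (hTi : ¬Dotted T i ∧ ¬Undotted T i)
    (hTi' : ¬Dotted T (i + 1) ∧ ¬Undotted T (i + 1))
    (hST : ∀ x, 0 < x → x ≠ i → x ≠ i + 1 →
      (Dotted T x ↔ Dotted S x) ∧ (Undotted T x ↔ Undotted S x)) :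
    (∀ z ∈ LSet n S, z ≠ i + 1 → matchCol n S z ≠ i →
      z ∈ LSet n T ∧ matchCol n T z = matchCol n S z) ∧
    (∀ z ∈ LSet n S, z ≠ i + 1 → matchCol n S z = i → (z ∈ LSet n T ↔ i + 1 ∈ LSet n S) ∧
      (i + 1 ∈ LSet n S → matchCol n T z = matchCol n S (i + 1))) ∧
    ∀ z ∈ LSet n T, z ∈ LSet n S ∧ z ≠ i + 1 := by
  have hTL : ∀ z ∈ LSet n T, z ≠ i ∧ z ≠ i + 1 := fun z hz => by
    have := (dotted_of_mem_LSet hz).2.2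
    exact ⟨fun h => hTi.1 (h ▸ this), fun h => hTi'.1 (h ▸ this)⟩
  have hSL : ∀ z ∈ LSet n S, z ≠ i := fun z hz h =>
    hSi.1 (h ▸ (dotted_of_mem_LSet hz).2.2.1)
  have hSm : ∀ z ∈ LSet n S, matchCol n S z ≠ z := fun z hz => mem_LSet.1 hz
  rcases matchCol_of_undotted_dotted hi hin hSi hSi' hTi hTi' hST with
    ⟨y, hy, hiy, -, -, hm, -⟩ | ⟨hy, -, hm, -⟩
  · rw [← matchCol_eq] at hy
    rw [← matchCol_eq, ← matchCol_eq] at hm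
    have hmem : i + 1 ∈ LSet n S := mem_LSet.2 (by omega)
    have hyu := (undotted_matchCol hmem).2.2
    rw [hy] at hyu
    refine ⟨fun z hz h₁ h₂ => ?_, fun z hz h₁ h₂ => ?_, fun z hz => ?_⟩
    · have hmz := hm z
      rw [if_neg h₁, if_neg fun h => h₂ h.1] at hmz
      exact ⟨mem_LSet.2 (hmz ▸ hSm z hz), hmz⟩
    · have hmz := hm z
      rw [if_neg h₁, if_pos ⟨h₂, hSL z hz⟩] at hmz
      have hyz : y ≠ z := fun h => hyu.1 (h ▸ (dotted_of_mem_LSet hz).2.2.1)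
      exact ⟨iff_of_true (mem_LSet.2 (hmz ▸ hyz)) hmem, fun _ => hmz.trans hy.symm⟩
    · refine ⟨mem_LSet.2 fun h => ?_, (hTL z hz).2⟩
      have hmz := hm z
      rw [if_neg (hTL z hz).2, if_neg fun h' => (hTL z hz).1 (h ▸ h'.1), h] at hmz
      exact mem_LSet.1 hz hmz
  · rw [← matchCol_eq] at hy
    rw [← matchCol_eq, ← matchCol_eq] at hm
    have hmem : i + 1 ∉ LSet n S := fun h => mem_LSet.1 h hy
    refine ⟨fun z hz h₁ h₂ => ?_, fun z hz h₁ h₂ => ?_, fun z hz => ?_⟩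
    · have hmz := hm z
      rw [if_neg h₂] at hmz
      exact ⟨mem_LSet.2 (hmz ▸ hSm z hz), hmz⟩
    · have hmz := hm z
      rw [if_pos h₂] at hmz
      exact ⟨iff_of_false (fun h => mem_LSet.1 h hmz) hmem, fun h => absurd h hmem⟩
    · refine ⟨mem_LSet.2 fun h => ?_, (hTL z hz).2⟩
      have hmz := hm z
      rw [h, ite_self] at hmz
      exact mem_LSet.1 hz hmz

theorem fop_bvecL_right_neg_right (hi : 0 < i) (hin : i < n) (hI : S ⊆ Iset n)
    (hS : i ∉ S ∧ i + 1 ∈ S ∧ -i ∉ S ∧ -(i + 1) ∈ S) :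
    fop n i (bvecL n S) = bvecL n (insert (-i) (S.erase (-(i + 1)))) := by
  obtain ⟨h₁, h₂, h₃, h₄⟩ := hS
  set T := insert (-i) (S.erase (-(i + 1))) with hT
  have hmT : ∀ z, z ∈ T ↔ z = -i ∨ z ≠ -(i + 1) ∧ z ∈ S := by simp [T]
  obtain ⟨hother, hlow, hback⟩ := matchCol_merge (S := S) (T := T) hi hin ⟨h₁, h₃⟩ ⟨h₂, h₄⟩
    (by grind) (by grind) (by grind)
  have hmi : ∀ X ⊆ LSet n S, i + 1 ∈ X → matchCol n S (i + 1) ≠ i := fun X hX h => by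
    have := (matchInv_matchCol n S).moved _ (mem_LSet.1 (hX h))
    simp only at this
    omega
  have hXd := fun X (hX : X ⊆ LSet n S) z (hz : z ∈ X) => dotted_of_mem_LSet (hX hz)
  have hYu := fun X (hX : X ⊆ LSet n S) y => undotted_of_mem_image hX (y := y)
  have hzero : ∀ X ⊆ LSet n S, ¬(i ∈ X.image (matchCol n S) ↔ i + 1 ∈ X) →
      fAct n i (exchange S X (X.image (matchCol n S))) = 0 := fun X hX hne => by
    have hXd := hXd X hX
    have hYu := hYu X hX
    set Y := X.image (matchCol n S)
    have e₁ : i ∈ exchange S X Y ↔ i ∈ Y := by grind [mem_exchange]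
    have e₂ : -i ∈ exchange S X Y ↔ i ∈ Y := by grind [mem_exchange]
    have e₃ : i + 1 ∈ exchange S X Y ↔ i + 1 ∉ X := by grind [mem_exchange]
    have e₄ : -(i + 1) ∈ exchange S X Y ↔ i + 1 ∉ X := by grind [mem_exchange]
    rw [fAct_of_lt hi hin]
    simp only [e₁, e₂, e₃, e₄]
    by_cases hY : i ∈ Y <;> by_cases hX : i + 1 ∈ X <;> simp [hX, hY] at hne ⊢
  rw [fop_bvecL i hI, bvecL_eq, ← Finset.sum_filter_of_ne
    (p := fun X => (i ∈ X.image (matchCol n S) ↔ i + 1 ∈ X)) fun X hX hne => by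
      by_contra h
      exact hne (by rw [hzero X (Finset.mem_powerset.1 hX) h, smul_zero])]
  refine Finset.sum_nbij' (fun X => X.erase (i + 1))
    (fun X => if i ∈ X.image (matchCol n S) then insert (i + 1) X else X)
    (fun X hX => ?_) (fun X hX => ?_) (fun X hX => ?_) (fun X hX => ?_) (fun X hX => ?_)
  · rw [Finset.mem_filter, Finset.mem_powerset] at hX
    rw [Finset.mem_powerset]
    intro z hz
    obtain ⟨hzi, hzX⟩ := Finset.mem_erase.1 hz
    by_cases hzm : matchCol n S z = i
    · exact (hlow z (hX.1 hzX) hzi hzm).1.2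
        (hX.1 (hX.2.1 (Finset.mem_image.2 ⟨z, hzX, hzm⟩)))
    · exact (hother z (hX.1 hzX) hzi hzm).1
  · rw [Finset.mem_powerset] at hX
    rw [Finset.mem_filter, Finset.mem_powerset]
    split_ifs with h
    · obtain ⟨z, hz, hzm⟩ := Finset.mem_image.1 h
      have hzT := hback z (hX hz)
      refine ⟨Finset.insert_subset ((hlow z hzT.1 hzT.2 hzm).1.1 (hX hz))
        fun w hw => (hback w (hX hw)).1, iff_of_true ?_ (Finset.mem_insert_self _ _)⟩
      exact Finset.mem_image.2 ⟨z, Finset.mem_insert_of_mem hz, hzm⟩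
    · exact ⟨fun w hw => (hback w (hX hw)).1,
        iff_of_false h fun h' => (hback _ (hX h')).2 rfl⟩
  · rw [Finset.mem_filter, Finset.mem_powerset] at hX
    have : i ∈ (X.erase (i + 1)).image (matchCol n S) ↔ i ∈ X.image (matchCol n S) := by
      simp only [Finset.mem_image, Finset.mem_erase]
      exact ⟨fun ⟨z, hz, h⟩ => ⟨z, hz.2, h⟩,
        fun ⟨z, hz, h⟩ => ⟨z, ⟨fun h' => hmi X hX.1 (h' ▸ hz) (h' ▸ h), hz⟩, h⟩⟩
    simp only [this, hX.2]
    split_ifs with h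
    · exact Finset.insert_erase h
    · exact Finset.erase_eq_of_notMem h
  · rw [Finset.mem_powerset] at hX
    have h : i + 1 ∉ X := fun h' => (hback _ (hX h')).2 rfl
    split_ifs
    · exact Finset.erase_insert h
    · exact Finset.erase_eq_of_notMem h
  · rw [Finset.mem_filter, Finset.mem_powerset] at hX
    obtain ⟨hX, hiff⟩ := hX
    have himg : (X.erase (i + 1)).image (matchCol n T) = (X.image (matchCol n S)).erase i := by
      have hmi := hmi X hX
      ext y
      simp only [Finset.mem_image, Finset.mem_erase] at hiff ⊢
      constructor
      · rintro ⟨z, ⟨hzi, hzX⟩, rfl⟩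
        by_cases hzm : matchCol n S z = i
        · have h := hiff.1 ⟨z, hzX, hzm⟩
          rw [(hlow z (hX hzX) hzi hzm).2 (hX h)]
          exact ⟨hmi h, _, h, rfl⟩
        · rw [(hother z (hX hzX) hzi hzm).2]
          exact ⟨hzm, z, hzX, rfl⟩
      · rintro ⟨hyi, z, hzX, rfl⟩
        by_cases hzi : z = i + 1
        · subst hzi
          obtain ⟨w, hwX, hwm⟩ := hiff.2 hzX
          have hwi : w ≠ i + 1 := by
            rintro rfl
            exact hyi hwm
          exact ⟨w, ⟨hwi, hwX⟩, (hlow w (hX hwX) hwi hwm).2 (hX hzX)⟩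
        · exact ⟨z, ⟨hzi, hzX⟩, (hother z (hX hzX) hzi hyi).2⟩
    have hXd := hXd X hX
    have hYu := hYu X hX
    clear hother hlow hback hzero hmi
    rw [himg]
    set Y := X.image (matchCol n S)
    by_cases h : i + 1 ∈ X
    · have hiY := hiff.2 h
      have hset : insert (i + 1) ((exchange S X Y).erase i) =
          exchange T (X.erase (i + 1)) (Y.erase i) := by
        ext z
        simp only [Finset.mem_insert, Finset.mem_erase, mem_exchange, hmT]
        grind
      have hcard : X.card = (X.erase (i + 1)).card + 1 := (Finset.card_erase_add_one h).symm
      have hq : qv ≠ 0 := RatFunc.X_ne_zero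
      rw [fAct_of_lt hi hin, if_neg, if_neg, if_neg, if_pos, hset, hcard, smul_smul, pow_succ,
        mul_assoc, inv_mul_cancel₀ hq, mul_one]
      all_goals grind [mem_exchange]
    · have hiY : i ∉ Y := fun h' => h (hiff.1 h')
      rw [Finset.erase_eq_of_notMem h, Finset.erase_eq_of_notMem hiY, fAct_of_lt hi hin,
        if_neg, if_neg, if_neg, if_neg, if_pos, exchange_replace, ← hT]
      all_goals grind [mem_exchange]

end cases

/-- the action of the Chevalley operators f_i on the canonical basis
vectors b_S is essentially coefficient free. -/
theorem stmt16 (n : ℕ) (hn : 1 ≤ n) :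
    (∀ i : ℤ, 1 ≤ i → i < (n : ℤ) → ∀ S : Bset n,
      (S.1 ∩ quad i = {i} →
        fop n i (bvecL n S.1) = bvecL n (insert (i + 1) (S.1.erase i))) ∧
      (S.1 ∩ quad i = {-(i + 1)} →
        fop n i (bvecL n S.1) = bvecL n (insert (-i) (S.1.erase (-(i + 1))))) ∧
      (S.1 ∩ quad i = ({i, -(i + 1)} : Finset ℤ) →
        fop n i (bvecL n S.1) = bvecL n (insert (-i) (S.1.erase (-(i + 1))))) ∧
      (S.1 ∩ quad i = ({i, -i} : Finset ℤ) →
        fop n i (bvecL n S.1) = (qv + qv⁻¹) • bvecL n (insert (i + 1) (S.1.erase i))) ∧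
      (S.1 ∩ quad i = ({i + 1, -(i + 1)} : Finset ℤ) →
        fop n i (bvecL n S.1) = bvecL n (insert (-i) (S.1.erase (-(i + 1))))) ∧
      (S.1 ∩ quad i = ({i, -(i + 1), -i} : Finset ℤ) →
        fop n i (bvecL n S.1) = bvecL n (insert (i + 1) (S.1.erase i))) ∧
      (S.1 ∩ quad i = ({i, i + 1, -(i + 1)} : Finset ℤ) →
        fop n i (bvecL n S.1) = bvecL n (insert (-i) (S.1.erase (-(i + 1)))))) ∧
    (∀ S : Bset n, (n : ℤ) ∈ S.1 → -(n : ℤ) ∉ S.1 →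
      fop n (n : ℤ) (bvecL n S.1) = bvecL n (insert (-(n : ℤ)) (S.1.erase (n : ℤ)))) := by
  refine ⟨fun i hi hin S => ?_, fun S => fop_bvecL_top S.2 hn⟩
  have hi' : 0 < i := hi
  rw [inter_quad_eq_left hi', inter_quad_eq_neg_right hi', inter_quad_eq_left_neg_right hi',
    inter_quad_eq_left_neg_left, inter_quad_eq_right_neg_right,
    inter_quad_eq_left_neg_right_neg_left hi', inter_quad_eq_left_right_neg_right hi']
  refine ⟨fun h => ?_, fun h => ?_, fop_bvecL_left_neg_right hi' hin S.2,
    fop_bvecL_left_neg_left hi' hin S.2, fop_bvecL_right_neg_right hi' hin S.2,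
    fun h => ?_, fun h => ?_⟩
  · rw [image_swapCol_eq_left hi' (by tauto) (by tauto),
      fop_bvecL_swap hi' hin S.2 (by tauto)]
  · rw [image_swapCol_eq_right hi' (by tauto) (by tauto),
      fop_bvecL_swap hi' hin S.2 (by tauto)]
  · rw [image_swapCol_eq_left hi' (by tauto) (by tauto),
      fop_bvecL_swap hi' hin S.2 (by tauto)]
  · rw [image_swapCol_eq_right hi' (by tauto) (by tauto),
      fop_bvecL_swap hi' hin S.2 (by tauto)]

end
end
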